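/- arXiv:1910.05590 — 2 statements merged into one kernel-verified Lean document; each statement's English description precedes it below -/
import Mathlib

section
/- Let $0<\beta<d$ and let $f\in W^{1,1}_{\mathrm{pol}}(\mathbb{S}^d)$ be nonnegative and Lipschitz. Let $\xi\in\mathbb{S}^d\setminus\{\mathbf{e},-\mathbf{e}\}$ and let $\overline{\mathcal{B}(\zeta,r)}\in\mathbf{B}_\xi^\beta$ with $\zeta$ in the half great circle determined by $\mathbf{e}$, $\xi$ and $-\mathbf{e}$. Assume $0\le\theta(\zeta)<\theta(\xi)$, that $\xi\in\partial\mathcal{B}(\zeta,r)$ and that $\widetilde{\mathcal{M}}_\beta f$ is differentiable at $\xi$. Then $\nabla\widetilde{\mathcal{M}}_\beta f(\xi)\cdot v(\xi,\mathbf{e}) = r^{\beta}\frac{\sigma'(r)}{\sigma(r)}\fint_{\mathcal{B}(\zeta,r)}\nabla f(\eta)\cdot v(\eta,\zeta)\,\frac{\sigma(d(\zeta,\eta))}{\sigma'(d(\zeta,\eta))}\,d\sigma(\eta) - \beta r^{\beta-1}\fint_{\mathcal{B}(\zeta,r)}f$; in particular, since this quantity is nonnegative, $|\nabla\widetilde{\mathcal{M}}_\beta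 f(\xi)| \le r^{\beta}\frac{\sigma'(r)}{\sigma(r)}\Big(\fint_{\mathcal{B}(\zeta,r)}f - \fint_{\partial\mathcal{B}(\zeta,r)}f\Big)$. -/
open MeasureTheory Metric Filter Topology Asymptotics
open scoped ENNReal RealInnerProductSpace NNReal

noncomputable section

/-- Euclidean space `ℝⁿ`. -/
abbrev Euc (n : ℕ) : Type := EuclideanSpace ℝ (Fin n)

/-- The unit sphere `𝕊^d ⊆ ℝ^(d+1)`. -/
abbrev Sph (d : ℕ) : Type := Metric.sphere (0 : Euc (d + 1)) 1

/-- The north pole `𝐞 = (1,0,…,0)`. -/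
def npole (d : ℕ) : Sph d :=
  ⟨EuclideanSpace.single 0 1, by
    rw [mem_sphere_zero_iff_norm, EuclideanSpace.norm_single]; norm_num⟩

/-- The south pole `-𝐞`. -/
def spole (d : ℕ) : Sph d :=
  ⟨-(npole d : Euc (d + 1)), by
    rw [mem_sphere_zero_iff_norm, norm_neg, ← mem_sphere_zero_iff_norm]
    exact (npole d).2⟩

/-- Geodesic distance on the sphere. -/
def geodist {d : ℕ} (ξ η : Sph d) : ℝ :=
  Real.arccos ⟪(ξ : Euc (d + 1)), (η : Euc (d + 1))⟫

/-- Open geodesic ball. -/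
def gball {d : ℕ} (ζ : Sph d) (r : ℝ) : Set (Sph d) := {η | geodist ζ η < r}

/-- Closed geodesic ball. -/
def gcball {d : ℕ} (ζ : Sph d) (r : ℝ) : Set (Sph d) := {η | geodist ζ η ≤ r}

/-- Geodesic sphere (boundary of a geodesic ball). -/
def gsphere {d : ℕ} (ζ : Sph d) (r : ℝ) : Set (Sph d) := {η | geodist ζ η = r}

/-- The surface measure `σ` on `𝕊^d`, as the `d`-dimensional Hausdorff measure. -/
def sphMeasure (d : ℕ) : Measure (Sph d) :=
  Measure.comap Subtype.val (MeasureTheory.Measure.hausdorffMeasure (d : ℝ))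

/-- The `(d-1)`-dimensional Hausdorff measure on `𝕊^d` (surface measure of boundaries of
geodesic balls). -/
def sphBdry (d : ℕ) : Measure (Sph d) :=
  Measure.comap Subtype.val (MeasureTheory.Measure.hausdorffMeasure ((d : ℝ) - 1))

/-- Polar angle `θ(ξ) = d(𝐞, ξ)`. -/
def polarAngle {d : ℕ} (ξ : Sph d) : ℝ := geodist (npole d) ξ

/-- `w(ξ) = min{θ(ξ), π - θ(ξ)}`. -/
def sphWidth {d : ℕ} (ξ : Sph d) : ℝ := min (polarAngle ξ) (Real.pi - polarAngle ξ)

/-- A function on the sphere is polar if it only depends on `ξ ⬝ 𝐞`. -/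
def IsPolar {d : ℕ} (f : Sph d → ℝ) : Prop :=
  ∀ ξ η : Sph d,
    ⟪(ξ : Euc (d + 1)), (npole d : Euc (d + 1))⟫ =
      ⟪(η : Euc (d + 1)), (npole d : Euc (d + 1))⟫ → f ξ = f η

/-- The uncentered fractional Hardy–Littlewood maximal function `𝓜̃_β f` on `𝕊^d`. -/
def sphMax {d : ℕ} (β : ℝ) (f : Sph d → ℝ) (ξ : Sph d) : ℝ :=
  sSup {a | ∃ ζ : Sph d, ∃ r : ℝ, 0 < r ∧ r ≤ Real.pi ∧ geodist ζ ξ ≤ r ∧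
    a = r ^ β * ⨍ η in gball ζ r, |f η| ∂(sphMeasure d)}

/-- The closed ball `B̄(ζ,r)` is a best ball for `𝓜̃_β f` at `ξ`, i.e. it contains `ξ` and
realizes the supremum defining `𝓜̃_β f (ξ)`. -/
def IsBestBall {d : ℕ} (β : ℝ) (f : Sph d → ℝ) (ξ ζ : Sph d) (r : ℝ) : Prop :=
  0 ≤ r ∧ r ≤ Real.pi ∧ geodist ζ ξ ≤ r ∧
    sphMax β f ξ = r ^ β * ⨍ η in gball ζ r, |f η| ∂(sphMeasure d)

/-- Projection onto the tangent space of the sphere at `η`. -/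
def tangProj {d : ℕ} (η : Sph d) (v : Euc (d + 1)) : Euc (d + 1) :=
  v - ⟪v, (η : Euc (d + 1))⟫ • (η : Euc (d + 1))

/-- `g` is the weak (tangential) gradient of `f` on `𝕊^d`: `g` is a.e. tangent and the
integration-by-parts formula against restrictions of smooth test functions holds. -/
def HasWeakGrad {d : ℕ} (f : Sph d → ℝ) (g : Sph d → Euc (d + 1)) : Prop :=
  (∀ᵐ η ∂(sphMeasure d), ⟪g η, (η : Euc (d + 1))⟫ = 0) ∧
  ∀ φ : Euc (d + 1) → ℝ, ContDiff ℝ (⊤ : ℕ∞) φ →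
    ∫ η, φ (η : Euc (d + 1)) • g η ∂(sphMeasure d)
      = - ∫ η, f η • tangProj η (gradient φ (η : Euc (d + 1))) ∂(sphMeasure d)
        + (d : ℝ) • ∫ η, (f η * φ (η : Euc (d + 1))) • (η : Euc (d + 1)) ∂(sphMeasure d)

/-- `f ∈ W^{1,1}(𝕊^d)`, with weak gradient `g`. -/
def MemW11 {d : ℕ} (f : Sph d → ℝ) (g : Sph d → Euc (d + 1)) : Prop :=
  Integrable f (sphMeasure d) ∧ Integrable g (sphMeasure d) ∧ HasWeakGrad f g

/-- Convergence `f_j → f` in `W^{1,1}(𝕊^d)` (with weak gradients `g_j, g`). -/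
def W11Tendsto {d : ℕ} (fj : ℕ → Sph d → ℝ) (gj : ℕ → Sph d → Euc (d + 1))
    (f : Sph d → ℝ) (g : Sph d → Euc (d + 1)) : Prop :=
  Tendsto (fun j => (∫ ξ, |fj j ξ - f ξ| ∂(sphMeasure d)) +
    ∫ ξ, ‖gj j ξ - g ξ‖ ∂(sphMeasure d)) atTop (nhds 0)

/-- `u : 𝕊^d → ℝ` is differentiable at `ξ` with (tangential) gradient `G`. -/
def HasSphereGradAt {d : ℕ} (u : Sph d → ℝ) (G : Euc (d + 1)) (ξ : Sph d) : Prop :=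
  ⟪G, (ξ : Euc (d + 1))⟫ = 0 ∧
    (fun η : Sph d => u η - u ξ - ⟪G, (η : Euc (d + 1)) - (ξ : Euc (d + 1))⟫)
      =o[nhds ξ] (fun η : Sph d => dist η ξ)

/-- The unit tangent vector at `η` pointing in the direction of the geodesic from `η` to `ζ`:
`v(η,ζ) = (ζ - (η·ζ)η)/|ζ - (η·ζ)η|`. -/
def gdir {d : ℕ} (η ζ : Sph d) : Euc (d + 1) :=
  ‖(ζ : Euc (d + 1)) - ⟪(η : Euc (d + 1)), (ζ : Euc (d + 1))⟫ • (η : Euc (d + 1))‖⁻¹ •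
    ((ζ : Euc (d + 1)) - ⟪(η : Euc (d + 1)), (ζ : Euc (d + 1))⟫ • (η : Euc (d + 1)))

/-- `S(η) = (η·v(ξ,𝐞))ξ - (η·ξ)v(ξ,𝐞)`. -/
def Svec {d : ℕ} (ξ η : Sph d) : Euc (d + 1) :=
  ⟪(η : Euc (d + 1)), gdir ξ (npole d)⟫ • (ξ : Euc (d + 1)) -
    ⟪(η : Euc (d + 1)), (ξ : Euc (d + 1))⟫ • gdir ξ (npole d)

/-- `ζ` lies on the (closed) half great circle determined by `𝐞`, `ξ` and `-𝐞`
(the one passing through `ξ`). -/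
def OnHalfGreatCircle {d : ℕ} (ξ ζ : Sph d) : Prop :=
  ∃ a b : ℝ, 0 ≤ b ∧ (ζ : Euc (d + 1)) = a • (npole d : Euc (d + 1)) +
    b • ((ξ : Euc (d + 1)) -
      ⟪(ξ : Euc (d + 1)), (npole d : Euc (d + 1))⟫ • (npole d : Euc (d + 1)))

/-- `σ(r)` up to the constant `κ_{d-1}`: `∫₀^r (sin t)^{d-1} dt`. -/
def sinInt (d : ℕ) (r : ℝ) : ℝ := ∫ t in (0:ℝ)..r, (Real.sin t) ^ (d - 1)

/-- `σ'(r)` up to the constant `κ_{d-1}`: `(sin r)^{d-1}`. -/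
def sinPow (d : ℕ) (r : ℝ) : ℝ := (Real.sin r) ^ (d - 1)

section


lemma unif_ball_pos {X : Type*} [MetricSpace X] [CompactSpace X] [MeasurableSpace X]
    [BorelSpace X] (μ : Measure X) [IsFiniteMeasure μ]
    (hμ : ∀ x y ε, μ (ball x ε) = μ (ball y ε)) (h0 : μ ≠ 0) (x : X) {ε : ℝ} (hε : 0 < ε) :
    0 < μ.real (ball x ε) := by
  by_contra hcon
  have hz : μ (ball x ε) = 0 := by
    have : μ.real (ball x ε) = 0 := le_antisymm (not_lt.1 hcon) measureReal_nonneg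
    exact (measureReal_eq_zero_iff).1 this
  obtain ⟨t, ht, hcov⟩ := isCompact_univ.elim_finite_subcover_image (b := Set.univ)
    (c := fun y : X => ball y ε) (fun _ _ => isOpen_ball)
    (fun y _ => Set.mem_iUnion₂.2 ⟨y, trivial, mem_ball_self hε⟩)
  apply h0
  rw [← Measure.measure_univ_eq_zero]
  refine measure_mono_null hcov.2 ?_
  rw [measure_biUnion_null_iff hcov.1.countable]
  intro y _
  rw [hμ y x, hz]

lemma unif_integral {X : Type*} [MetricSpace X] [CompactSpace X] [MeasurableSpace X]
    [BorelSpace X] (μ ν : Measure X) [IsFiniteMeasure μ] [IsFiniteMeasure ν]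
    (hμ : ∀ x y ε, μ (ball x ε) = μ (ball y ε))
    (hν : ∀ x y ε, ν (ball x ε) = ν (ball y ε)) (h0 : μ ≠ 0) (f : X → ℝ) (hf : Continuous f) :
    ν.real Set.univ * ∫ x, f x ∂μ = μ.real Set.univ * ∫ x, f x ∂ν := by
  rcases isEmpty_or_nonempty X with hX | ⟨⟨x0⟩⟩
  · exact absurd (Measure.eq_zero_of_isEmpty μ) h0
  obtain ⟨C, hC⟩ : ∃ C, ∀ x, ‖f x‖ ≤ C := by
    obtain ⟨C, hC⟩ := isCompact_univ.exists_bound_of_continuousOn hf.continuousOn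
    exact ⟨C, fun x => hC x trivial⟩
  have hfi : ∀ (m : Measure X) [IsFiniteMeasure m], Integrable f m := fun m _ =>
    Integrable.of_bound hf.aestronglyMeasurable C (ae_of_all _ hC)
  have key : ∀ δ > 0, |ν.real Set.univ * ∫ x, f x ∂μ - μ.real Set.univ * ∫ x, f x ∂ν| ≤
      δ * (ν.real Set.univ * μ.real Set.univ) := by
    intro δ hδ
    obtain ⟨ε, hε, hu⟩ := Metric.uniformContinuous_iff.1
      (CompactSpace.uniformContinuous_of_continuous hf) δ hδ
    set a := μ.real (ball x0 ε) with ha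
    set b := ν.real (ball x0 ε) with hb
    have hapos : 0 < a := unif_ball_pos μ hμ h0 x0 hε
    have hμa : ∀ x, μ.real (ball x ε) = a := fun x => by simp only [ha, Measure.real, hμ x x0]
    have hνb : ∀ x, ν.real (ball x ε) = b := fun x => by simp only [hb, Measure.real, hν x x0]
    have hS : MeasurableSet {p : X × X | dist p.1 p.2 < ε} :=
      (isOpen_lt (by fun_prop) continuous_const).measurableSet
    have fub : ∀ h : X → ℝ, Continuous h → b * ∫ x, h x ∂μ
        = ∫ y, (∫ x in ball y ε, h x ∂μ) ∂ν := by
      intro h hh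
      obtain ⟨D, hD⟩ := isCompact_univ.exists_bound_of_continuousOn hh.continuousOn
      have hInt : Integrable (Function.uncurry fun x y =>
          ({p : X × X | dist p.1 p.2 < ε}).indicator (fun p => h p.1) (x, y)) (μ.prod ν) := by
        refine Integrable.indicator (f := fun p : X × X => h p.1) ?_ hS
        refine Integrable.of_bound (hh.comp continuous_fst).aestronglyMeasurable D
          (ae_of_all _ fun p => hD _ trivial)
      have := integral_integral_swap hInt
      have e1 : ∀ x, ∫ y, ({p : X × X | dist p.1 p.2 < ε}).indicator (fun p => h p.1) (x, y) ∂ν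
          = b * h x := by
        intro x
        have : (fun y => ({p : X × X | dist p.1 p.2 < ε}).indicator (fun p => h p.1) (x, y))
            = (ball x ε).indicator (fun _ => h x) := by
          ext y
          simp only [Set.indicator, Set.mem_ofPred_eq, mem_ball, dist_comm x y]
        rw [this, integral_indicator measurableSet_ball, setIntegral_const, hνb, smul_eq_mul]
      have e2 : ∀ y, ∫ x, ({p : X × X | dist p.1 p.2 < ε}).indicator (fun p => h p.1) (x, y) ∂μ
          = ∫ x in ball y ε, h x ∂μ := by
        intro y
        rw [← integral_indicator measurableSet_ball]
        rfl
      simp only [e1, e2] at this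
      rw [← this, integral_const_mul]
    have f1 := fub (fun _ => 1) continuous_const
    simp only [integral_const, smul_eq_mul, mul_one, measureReal_restrict_apply_univ, hμa] at f1
    have f2 := fub f hf
    have f3 : |b * ∫ x, f x ∂μ - a * ∫ y, f y ∂ν| ≤ δ * a * ν.real Set.univ := by
      rw [f2, ← integral_const_mul, ← integral_sub]
      · rw [← Real.norm_eq_abs]
        refine norm_integral_le_of_norm_le_const (ae_of_all _ fun y => ?_)
        have : (∫ x in ball y ε, f x ∂μ) - a * f y = ∫ x in ball y ε, (f x - f y) ∂μ := by
          rw [integral_sub (hfi _) (integrable_const _), setIntegral_const, hμa, smul_eq_mul]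
        rw [this]
        have := norm_setIntegral_le_of_norm_le_const (μ := μ) (s := ball y ε)
          (f := fun x => f x - f y) (C := δ) (measure_lt_top _ _)
          (fun x hx => by rw [← dist_eq_norm]; exact (hu hx).le)
        rwa [hμa] at this
      · refine Integrable.of_bound (C := C * μ.real Set.univ) ?_ (ae_of_all _ fun y => ?_)
        · have : (fun y => ∫ x in ball y ε, f x ∂μ) = fun y => ∫ x,
            ({p : X × X | dist p.2 p.1 < ε}).indicator (fun p => f p.2) (y, x) ∂μ := by
            ext y
            rw [← integral_indicator measurableSet_ball]
            rfl
          rw [this]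
          refine StronglyMeasurable.aestronglyMeasurable ?_
          refine StronglyMeasurable.integral_prod_right' (f := ({p : X × X | dist p.2 p.1 < ε}).indicator (fun p => f p.2)) ?_
          refine StronglyMeasurable.indicator ?_ ?_
          · exact (hf.comp continuous_snd).stronglyMeasurable
          · exact (isOpen_lt (by fun_prop) continuous_const).measurableSet
        · refine (norm_setIntegral_le_of_norm_le_const (measure_lt_top _ _)
            (fun x _ => hC x)).trans ?_
          exact mul_le_mul_of_nonneg_left (measureReal_mono (Set.subset_univ _))
            ((norm_nonneg _).trans (hC x0))
      · exact (hfi ν).const_mul _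
    have hab : b * μ.real Set.univ = a * ν.real Set.univ := by
      rw [f1, mul_comm]
    have hm : 0 ≤ μ.real Set.univ := measureReal_nonneg
    have h5 : a * |ν.real Set.univ * ∫ x, f x ∂μ - μ.real Set.univ * ∫ x, f x ∂ν|
        = μ.real Set.univ * |b * ∫ x, f x ∂μ - a * ∫ y, f y ∂ν| := by
      calc _ = |a * (ν.real Set.univ * ∫ x, f x ∂μ - μ.real Set.univ * ∫ x, f x ∂ν)| := by
            rw [abs_mul, abs_of_pos hapos]
        _ = |μ.real Set.univ * (b * ∫ x, f x ∂μ - a * ∫ y, f y ∂ν)| := by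
            congr 1
            linear_combination -(∫ x, f x ∂μ) * hab
        _ = _ := by rw [abs_mul, abs_of_nonneg hm]
    refine le_of_mul_le_mul_left ?_ hapos
    rw [h5]
    calc _ ≤ μ.real Set.univ * (δ * a * ν.real Set.univ) := by gcongr
      _ = _ := by ring
  have : |ν.real Set.univ * ∫ x, f x ∂μ - μ.real Set.univ * ∫ x, f x ∂ν| ≤ 0 := by
    refine le_of_forall_pos_le_add fun δ hδ => ?_
    rw [zero_add]
    set M := ν.real Set.univ * μ.real Set.univ
    have hM : 0 ≤ M := by positivity
    refine (key (δ / (M + 1)) (by positivity)).trans ?_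
    rw [div_mul_eq_mul_div, div_le_iff₀ (by positivity)]
    nlinarith
  exact sub_eq_zero.1 (abs_nonpos_iff.1 this)

lemma unif_measure {X : Type*} [MetricSpace X] [CompactSpace X] [MeasurableSpace X]
    [BorelSpace X] (μ ν : Measure X) [IsFiniteMeasure μ] [IsFiniteMeasure ν]
    (hμ : ∀ x y ε, μ (ball x ε) = μ (ball y ε))
    (hν : ∀ x y ε, ν (ball x ε) = ν (ball y ε)) (h0 : μ ≠ 0) :
    ν = (ν Set.univ / μ Set.univ) • μ := by
  have hu0 : μ Set.univ ≠ 0 := by simpa using h0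
  have : IsFiniteMeasure ((ν Set.univ / μ Set.univ) • μ) :=
    Measure.smul_finite _ (ENNReal.div_lt_top (measure_ne_top _ _) hu0).ne
  apply ext_of_forall_integral_eq_of_IsFiniteMeasure
  intro f
  have := unif_integral μ ν hμ hν h0 f f.continuous
  rw [integral_smul_measure, ENNReal.toReal_div, smul_eq_mul]
  have h1 : (μ Set.univ).toReal ≠ 0 := (ENNReal.toReal_pos hu0 (measure_ne_top _ _)).ne'
  simp only [Measure.real] at this
  field_simp
  linarith

lemma sph_transitive {E : Type*} [NormedAddCommGroup E] [InnerProductSpace ℝ E]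
    (x y : sphere (0 : E) 1) : ∃ T : E ≃ₗᵢ[ℝ] E, T x = y := by
  refine ⟨Submodule.reflection (ℝ ∙ ((x : E) - y))ᗮ, ?_⟩
  apply Submodule.reflection_sub
  rw [norm_eq_of_mem_sphere, norm_eq_of_mem_sphere]

/-- the action of a linear isometry on the sphere -/
def sphAct {E : Type*} [NormedAddCommGroup E] [InnerProductSpace ℝ E] (T : E ≃ₗᵢ[ℝ] E)
    (x : sphere (0 : E) 1) : sphere (0 : E) 1 := ⟨T x, by simp⟩

lemma sphAct_ball {E : Type*} [NormedAddCommGroup E] [InnerProductSpace ℝ E] (T : E ≃ₗᵢ[ℝ] E)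
    (x : sphere (0 : E) 1) (ε : ℝ) : sphAct T ⁻¹' (ball (sphAct T x) ε) = ball x ε := by
  ext y
  simp [sphAct, mem_ball, Subtype.dist_eq]

lemma sphAct_cont {E : Type*} [NormedAddCommGroup E] [InnerProductSpace ℝ E] (T : E ≃ₗᵢ[ℝ] E) :
    Continuous (sphAct T) := by
  unfold sphAct
  fun_prop

lemma sph_unique {E : Type*} [NormedAddCommGroup E] [InnerProductSpace ℝ E]
    [FiniteDimensional ℝ E] [MeasurableSpace E] [BorelSpace E]
    (μ ν : Measure (sphere (0 : E) 1)) [IsFiniteMeasure μ] [IsFiniteMeasure ν]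
    (hμ : ∀ (T : E ≃ₗᵢ[ℝ] E) (s : Set (sphere (0 : E) 1)), MeasurableSet s →
      μ (sphAct T ⁻¹' s) = μ s)
    (hν : ∀ (T : E ≃ₗᵢ[ℝ] E) (s : Set (sphere (0 : E) 1)), MeasurableSet s →
      ν (sphAct T ⁻¹' s) = ν s) (h0 : μ ≠ 0) :
    ν = (ν Set.univ / μ Set.univ) • μ := by
  have : ∀ (m : Measure (sphere (0 : E) 1)), (∀ (T : E ≃ₗᵢ[ℝ] E) (s : Set (sphere (0 : E) 1)),
      MeasurableSet s → m (sphAct T ⁻¹' s) = m s) → ∀ x y ε, m (ball x ε) = m (ball y ε) := by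
    intro m hm x y ε
    obtain ⟨T, hT⟩ := sph_transitive x y
    have e : y = sphAct T x := Subtype.ext hT.symm
    rw [e, ← hm T (ball (sphAct T x) ε) measurableSet_ball, sphAct_ball]
  exact unif_measure μ ν (this μ hμ) (this ν hν) h0

end

section
open scoped ENNReal RealInnerProductSpace NNReal Pointwise

lemma hemi_finite {E : Type*} [NormedAddCommGroup E] [InnerProductSpace ℝ E]
    [FiniteDimensional ℝ E] [MeasurableSpace E] [BorelSpace E] (n : ℕ)
    (hn : Module.finrank ℝ E = n + 1) (v : E) (hv : ‖v‖ = 1) :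
    Measure.hausdorffMeasure (n : ℝ) {x : E | x ∈ sphere (0 : E) 1 ∧ ⟪v, x⟫ ≤ 0} < ∞ := by
  have : Fact (Module.finrank ℝ E = n + 1) := ⟨hn⟩
  have hv0 : v ≠ 0 := by rintro rfl; simp at hv
  set K : Set E := {x : E | x ∈ sphere (0 : E) 1 ∧ ⟪v, x⟫ ≤ 0} with hK
  have hKc : IsCompact K := by
    refine (isCompact_sphere (0 : E) 1).inter_right (t := {x : E | ⟪v, x⟫ ≤ 0}) ?_
    exact isClosed_le (by fun_prop) continuous_const
  have hCc : IsCompact (stereoToFun v '' K) := by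
    refine hKc.image_of_continuousOn (continuousOn_stereoToFun.mono ?_)
    intro x hx
    have := hx.2
    simp only [Set.mem_ofPred_eq, innerSL_apply_apply]
    intro h
    rw [h] at this
    norm_num at this
  have hsub : K ⊆ (fun w : (ℝ ∙ v)ᗮ => stereoInvFunAux v (w : E)) '' (stereoToFun v '' K) := by
    intro x hx
    refine ⟨_, ⟨x, hx, rfl⟩, ?_⟩
    have hne : x ≠ v := by
      rintro rfl
      have := hx.2
      rw [real_inner_self_eq_norm_sq, hv] at this
      norm_num at this
    have := stereo_left_inv hv (x := ⟨x, hx.1⟩) hne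
    exact congrArg Subtype.val this
  have hll : LocallyLipschitz (fun w : (ℝ ∙ v)ᗮ => stereoInvFunAux v (w : E)) := by
    have : ContDiff ℝ 1 (fun w : (ℝ ∙ v)ᗮ => stereoInvFunAux v (w : E)) :=
      contDiff_stereoInvFunAux.comp (ℝ ∙ v)ᗮ.subtypeL.contDiff
    exact this.locallyLipschitz
  obtain ⟨L, hL⟩ := (hll.locallyLipschitzOn).exists_lipschitzOnWith_of_compact hCc
  have hfr : Module.finrank ℝ (ℝ ∙ v)ᗮ = n := Submodule.finrank_orthogonal_span_singleton hv0
  have hfin : Measure.hausdorffMeasure (n : ℝ) (stereoToFun v '' K) < ∞ := by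
    have : (Measure.hausdorffMeasure (n : ℝ) : Measure (ℝ ∙ v)ᗮ).IsAddHaarMeasure := by
      rw [← hfr]; infer_instance
    exact hCc.measure_lt_top
  refine (measure_mono hsub).trans_lt ?_
  refine (hL.hausdorffMeasure_image_le (Nat.cast_nonneg n)).trans_lt ?_
  exact ENNReal.mul_lt_top (ENNReal.rpow_lt_top_of_nonneg (Nat.cast_nonneg n) ENNReal.coe_ne_top) hfin

lemma sphere_haus_finite {E : Type*} [NormedAddCommGroup E] [InnerProductSpace ℝ E]
    [FiniteDimensional ℝ E] [MeasurableSpace E] [BorelSpace E] (n : ℕ)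
    (hn : Module.finrank ℝ E = n + 1) :
    Measure.hausdorffMeasure (n : ℝ) (sphere (0 : E) 1) < ∞ := by
  have : Nontrivial E := Module.nontrivial_of_finrank_pos (R := ℝ) (by omega)
  obtain ⟨v, hv⟩ := exists_norm_eq E (zero_le_one)
  refine (measure_mono (t := {x : E | x ∈ sphere (0 : E) 1 ∧ ⟪v, x⟫ ≤ 0} ∪
    {x : E | x ∈ sphere (0 : E) 1 ∧ ⟪-v, x⟫ ≤ 0}) ?_).trans_lt ?_
  · intro x hx
    rcases le_total ⟪v, x⟫ 0 with h | h
    · exact Or.inl ⟨hx, h⟩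
    · refine Or.inr ⟨hx, ?_⟩
      rw [inner_neg_left]
      linarith
  · refine measure_union_lt_top (hemi_finite n hn v hv) (hemi_finite n hn (-v) ?_)
    rw [norm_neg, hv]

lemma sphere_haus_pos {E : Type*} [NormedAddCommGroup E] [InnerProductSpace ℝ E]
    [FiniteDimensional ℝ E] [MeasurableSpace E] [BorelSpace E] (n : ℕ)
    (hn : Module.finrank ℝ E = n + 1) :
    0 < Measure.hausdorffMeasure (n : ℝ) (sphere (0 : E) 1) := by
  have : Fact (Module.finrank ℝ E = n + 1) := ⟨hn⟩
  have : Nontrivial E := Module.nontrivial_of_finrank_pos (R := ℝ) (by omega)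
  obtain ⟨v, hv⟩ := exists_norm_eq E (zero_le_one)
  have hv0 : v ≠ 0 := by rintro rfl; simp at hv
  have hfr : Module.finrank ℝ (ℝ ∙ v)ᗮ = n := Submodule.finrank_orthogonal_span_singleton hv0
  have hH : (Measure.hausdorffMeasure (n : ℝ) : Measure (ℝ ∙ v)ᗮ).IsAddHaarMeasure := by
    rw [← hfr]; infer_instance
  have hpos : 0 < (Measure.hausdorffMeasure (n : ℝ)) (ball (0 : (ℝ ∙ v)ᗮ) 1) :=
    measure_ball_pos _ _ one_pos
  refine hpos.trans_le ?_
  refine le_trans (measure_mono ?_) (hausdorffMeasure_orthogonalProjectionOnto_le (ℝ ∙ v)ᗮ n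
    (sphere (0 : E) 1) (Nat.cast_nonneg n))
  intro w hw
  rw [mem_ball_zero_iff] at hw
  have hwv : ⟪(w : E), v⟫ = 0 := by
    have := w.2
    rw [Submodule.mem_orthogonal_singleton_iff_inner_left] at this
    exact this
  refine ⟨(w : E) + √(1 - ‖w‖ ^ 2) • v, ?_, ?_⟩
  · rw [mem_sphere_zero_iff_norm]
    have h1 : 0 ≤ 1 - ‖w‖ ^ 2 := by nlinarith [norm_nonneg w]
    have : ‖(w : E) + √(1 - ‖w‖ ^ 2) • v‖ ^ 2 = 1 := by
      rw [norm_add_sq_real, inner_smul_right, hwv, norm_smul, hv, mul_one, Real.norm_eq_abs, sq_abs,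
        Real.sq_sqrt h1]
      simp
    have h0 := norm_nonneg ((w : E) + √(1 - ‖w‖ ^ 2) • v)
    nlinarith
  · rw [map_add, map_smul, Submodule.orthogonalProjectionOnto_mem_subspace_eq_self,
      Submodule.orthogonalProjectionOnto_orthogonal_apply_eq_zero, smul_zero, add_zero]
    exact Submodule.mem_span_singleton_self v

/-- Hausdorff measure on the sphere -/
def hausSph (E : Type*) [NormedAddCommGroup E] [InnerProductSpace ℝ E]
    [MeasurableSpace E] [BorelSpace E] (n : ℝ) : Measure (sphere (0 : E) 1) :=
  Measure.comap Subtype.val (Measure.hausdorffMeasure n)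

lemma hausSph_apply {E : Type*} [NormedAddCommGroup E] [InnerProductSpace ℝ E]
    [MeasurableSpace E] [BorelSpace E] (n : ℝ) (s : Set (sphere (0 : E) 1)) :
    hausSph E n s = Measure.hausdorffMeasure n (Subtype.val '' s) :=
  (MeasurableEmbedding.subtype_coe isClosed_sphere.measurableSet).comap_apply _ _

lemma image_sphAct {E : Type*} [NormedAddCommGroup E] [InnerProductSpace ℝ E]
    (T : E ≃ₗᵢ[ℝ] E) (s : Set (sphere (0 : E) 1)) :
    Subtype.val '' (sphAct T ⁻¹' s) = T ⁻¹' (Subtype.val '' s) := by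
  ext x
  constructor
  · rintro ⟨y, hy, rfl⟩
    exact ⟨_, hy, rfl⟩
  · rintro ⟨y, hy, hyx⟩
    refine ⟨⟨x, ?_⟩, ?_, rfl⟩
    · rw [mem_sphere_zero_iff_norm, ← T.norm_map, ← hyx, norm_eq_of_mem_sphere]
    · have : sphAct T ⟨x, by rw [mem_sphere_zero_iff_norm, ← T.norm_map, ← hyx, norm_eq_of_mem_sphere]⟩ = y :=
        Subtype.ext hyx.symm
      simpa only [Set.mem_preimage, this] using hy

lemma hausSph_inv {E : Type*} [NormedAddCommGroup E] [InnerProductSpace ℝ E]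
    [MeasurableSpace E] [BorelSpace E] (n : ℝ) (T : E ≃ₗᵢ[ℝ] E) (s : Set (sphere (0 : E) 1)) :
    hausSph E n (sphAct T ⁻¹' s) = hausSph E n s := by
  rw [hausSph_apply, hausSph_apply, image_sphAct]
  exact T.toIsometryEquiv.hausdorffMeasure_preimage n _

lemma hausSph_univ {E : Type*} [NormedAddCommGroup E] [InnerProductSpace ℝ E]
    [MeasurableSpace E] [BorelSpace E] (n : ℝ) :
    hausSph E n Set.univ = Measure.hausdorffMeasure n (sphere (0 : E) 1) := by
  rw [hausSph_apply, Set.image_univ, Subtype.range_coe]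

lemma toSphere_inv {E : Type*} [NormedAddCommGroup E] [InnerProductSpace ℝ E]
    [FiniteDimensional ℝ E]
    [MeasurableSpace E] [BorelSpace E] (T : E ≃ₗᵢ[ℝ] E) (s : Set (sphere (0 : E) 1))
    (hs : MeasurableSet s) :
    (volume : Measure E).toSphere (sphAct T ⁻¹' s) = (volume : Measure E).toSphere s := by
  rw [Measure.toSphere_apply' _ hs, Measure.toSphere_apply' _ ((sphAct_cont T).measurable hs),
    image_sphAct]
  congr 1
  have : Set.Ioo (0 : ℝ) 1 • (T ⁻¹' (Subtype.val '' s)) =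
      T ⁻¹' (Set.Ioo (0 : ℝ) 1 • (Subtype.val '' s)) := by
    ext x
    simp only [Set.mem_smul, Set.mem_preimage]
    constructor
    · rintro ⟨a, ha, y, hy, rfl⟩
      exact ⟨a, ha, T y, hy, by simp⟩
    · rintro ⟨a, ha, y, hy, h⟩
      refine ⟨a, ha, T.symm y, by simpa using hy, ?_⟩
      apply T.injective
      simp [h]
  rw [this]
  exact T.measurePreserving.measure_preimage_equiv (f := T.toMeasurableEquiv) _

lemma hausSph_eq {E : Type*} [NormedAddCommGroup E] [InnerProductSpace ℝ E]
    [FiniteDimensional ℝ E] [MeasurableSpace E] [BorelSpace E] (n : ℕ)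
    (hn : Module.finrank ℝ E = n + 1) :
    ∃ c : ℝ≥0∞, c ≠ 0 ∧ c ≠ ∞ ∧ hausSph E n = c • (volume : Measure E).toSphere := by
  have : Nontrivial E := Module.nontrivial_of_finrank_pos (R := ℝ) (by omega)
  have hfin : IsFiniteMeasure (hausSph E n) := ⟨by
    rw [hausSph_univ]; exact sphere_haus_finite n hn⟩
  have h0 : (volume : Measure E).toSphere ≠ 0 := Measure.toSphere_ne_zero _
  refine ⟨_, ?_, ?_, sph_unique (volume : Measure E).toSphere (hausSph E n)
    (fun T s hs => toSphere_inv T s hs) (fun T s _ => hausSph_inv n T s) h0⟩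
  · refine ENNReal.div_ne_zero.2 ⟨?_, measure_ne_top _ _⟩
    rw [hausSph_univ]; exact (sphere_haus_pos n hn).ne'
  · exact (ENNReal.div_lt_top (measure_ne_top _ _) (Measure.measure_univ_ne_zero.2 h0)).ne

end

section


lemma lint_polar {V : Type*} [NormedAddCommGroup V] [InnerProductSpace ℝ V]
    [FiniteDimensional ℝ V] [MeasurableSpace V] [BorelSpace V] [Nontrivial V]
    (G : V → ℝ≥0∞) (hG : Measurable G) :
    ∫⁻ x, G x = ∫⁻ ω, (∫⁻ ρ in Set.Ioi (0 : ℝ),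
      ENNReal.ofReal (ρ ^ (Module.finrank ℝ V - 1)) * G (ρ • (ω : V)))
        ∂((volume : Measure V).toSphere) := by
  have h1 : ∫⁻ x, G x = ∫⁻ x in ({0}ᶜ : Set V), G x := by
    rw [restrict_compl_singleton]
  rw [h1, ← lintegral_subtype_comap (measurableSet_singleton _).compl]
  have hmp := (volume : Measure V).measurePreserving_homeomorphUnitSphereProd
  have h2 := hmp.lintegral_comp (f := fun p : sphere (0 : V) 1 × Set.Ioi (0 : ℝ) =>
    G (p.2.1 • (p.1 : V))) (by fun_prop)
  have h3 : ∀ x : ({0}ᶜ : Set V), G (((homeomorphUnitSphereProd V) x).2.1 •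
      (((homeomorphUnitSphereProd V) x).1 : V)) = G x := by
    intro x
    congr 1
    have hx : ‖(x : V)‖ ≠ 0 := norm_ne_zero_iff.2 x.2
    simp [smul_smul, hx]
  simp only [h3] at h2
  rw [h2, lintegral_prod _ (by fun_prop)]
  refine lintegral_congr fun ω => ?_
  rw [Measure.volumeIoiPow, lintegral_withDensity_eq_lintegral_mul _ (by fun_prop) (by fun_prop)]
  simp only [Pi.mul_apply]
  rw [lintegral_subtype_comap measurableSet_Ioi
    (fun ρ : ℝ => ENNReal.ofReal (ρ ^ (Module.finrank ℝ V - 1)) * G (ρ • (ω : V)))]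

/-- the radial projection to the sphere (with value `ω0` at the origin) -/
def radProj {E : Type*} [NormedAddCommGroup E] [InnerProductSpace ℝ E]
    (ω0 : sphere (0 : E) 1) (x : E) : sphere (0 : E) 1 :=
  ⟨open Classical in if x = 0 then (ω0 : E) else ‖x‖⁻¹ • x, by
    split_ifs with h
    · exact ω0.2
    · have : ‖x‖ ≠ 0 := norm_ne_zero_iff.2 h
      simp [norm_smul, this]⟩

lemma radProj_meas {E : Type*} [NormedAddCommGroup E] [InnerProductSpace ℝ E]
    [FiniteDimensional ℝ E] [MeasurableSpace E] [BorelSpace E]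
    (ω0 : sphere (0 : E) 1) : Measurable (radProj ω0) := by
  apply Measurable.subtype_mk
  apply Measurable.ite (measurableSet_singleton (0 : E)) measurable_const
  fun_prop

lemma radProj_smul {E : Type*} [NormedAddCommGroup E] [InnerProductSpace ℝ E]
    (ω0 ω : sphere (0 : E) 1) {R : ℝ} (hR : 0 < R) : radProj ω0 (R • (ω : E)) = ω := by
  apply Subtype.ext
  have h1 : ‖(ω : E)‖ = 1 := norm_eq_of_mem_sphere ω
  have h0 : (ω : E) ≠ 0 := by
    intro h; rw [h] at h1; simp at h1
  simp only [radProj]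
  rw [if_neg (smul_ne_zero hR.ne' h0), norm_smul, h1, mul_one, Real.norm_of_nonneg hR.le, smul_smul,
    inv_mul_cancel₀ hR.ne', one_smul]

/-- polar coordinates on the sphere around `ζ` -/
def polMap {E F : Type*} [NormedAddCommGroup E] [InnerProductSpace ℝ E]
    [NormedAddCommGroup F] [InnerProductSpace ℝ F] (ζ : sphere (0 : E) 1) (L : F →ₗᵢ[ℝ] E)
    (hL : ∀ z, ⟪(ζ : E), L z⟫ = 0) (t : ℝ) (ω : sphere (0 : F) 1) : sphere (0 : E) 1 :=
  ⟨Real.cos t • (ζ : E) + Real.sin t • L ω, by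
    rw [mem_sphere_zero_iff_norm]
    have h1 : ‖(ζ : E)‖ = 1 := norm_eq_of_mem_sphere ζ
    have h2 : ‖(ω : F)‖ = 1 := norm_eq_of_mem_sphere ω
    have : ‖Real.cos t • (ζ : E) + Real.sin t • L ω‖ ^ 2 = 1 := by
      rw [norm_add_sq_real, inner_smul_left, inner_smul_right, hL, norm_smul, norm_smul, h1,
        L.norm_map, h2]
      simp
    have h0 := norm_nonneg (Real.cos t • (ζ : E) + Real.sin t • L ω)
    nlinarith⟩

lemma polMap_cont {E F : Type*} [NormedAddCommGroup E] [InnerProductSpace ℝ E]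
    [NormedAddCommGroup F] [InnerProductSpace ℝ F] (ζ : sphere (0 : E) 1) (L : F →ₗᵢ[ℝ] E)
    (hL : ∀ z, ⟪(ζ : E), L z⟫ = 0) :
    Continuous (fun p : ℝ × sphere (0 : F) 1 => polMap ζ L hL p.1 p.2) := by
  unfold polMap
  refine Continuous.subtype_mk ?_ _
  have := L.continuous
  fun_prop

lemma haar_prod {E F : Type*} [NormedAddCommGroup E] [InnerProductSpace ℝ E]
    [FiniteDimensional ℝ E] [MeasurableSpace E] [BorelSpace E]
    [NormedAddCommGroup F] [InnerProductSpace ℝ F]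
    [FiniteDimensional ℝ F] [MeasurableSpace F] [BorelSpace F]
    (ζ : sphere (0 : E) 1) (L : F →ₗᵢ[ℝ] E)
    (hL : ∀ z, ⟪(ζ : E), L z⟫ = 0) (hdim : Module.finrank ℝ E = Module.finrank ℝ F + 1) :
    ∃ c : ℝ≥0∞, c ≠ 0 ∧ c ≠ ∞ ∧ ∀ G : E → ℝ≥0∞, Measurable G →
      ∫⁻ x, G x = c * ∫⁻ p : ℝ × F, G (p.1 • (ζ : E) + L p.2) := by
  let A : (ℝ × F) →ₗ[ℝ] E := (LinearMap.toSpanSingleton ℝ E (ζ : E)).coprod L.toLinearMap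
  have hA : ∀ p : ℝ × F, A p = p.1 • (ζ : E) + L p.2 := fun p => rfl
  have hinj : Function.Injective A := by
    rw [← LinearMap.ker_eq_bot, LinearMap.ker_eq_bot']
    rintro ⟨y, z⟩ h
    rw [hA] at h
    simp only at h
    have h1 : ⟪(ζ : E), y • (ζ : E) + L z⟫ = y := by
      rw [inner_add_right, hL, inner_smul_right, real_inner_self_eq_norm_sq,
        norm_eq_of_mem_sphere]
      simp
    have hy : y = 0 := by rw [← h1, h, inner_zero_right]
    subst hy
    rw [zero_smul, zero_add] at h
    have : z = 0 := L.injective (by rw [h, map_zero])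
    rw [this]; rfl
  have hfr : Module.finrank ℝ (ℝ × F) = Module.finrank ℝ E := by
    rw [Module.finrank_prod, hdim, Module.finrank_self, add_comm]
  let A' : (ℝ × F) ≃L[ℝ] E := (LinearEquiv.ofInjectiveOfFinrankEq A hinj hfr).toContinuousLinearEquiv
  have hA' : ∀ p : ℝ × F, A' p = p.1 • (ζ : E) + L p.2 := fun p => rfl
  set V : Measure (ℝ × F) := (volume : Measure ℝ).prod (volume : Measure F) with hV
  have hh : (Measure.map A' V).IsAddHaarMeasure := A'.isAddHaarMeasure_map V
  have hc := Measure.isAddLeftInvariant_eq_smul (volume : Measure E) (Measure.map A' V)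
  set c := Measure.addHaarScalarFactor (volume : Measure E) (Measure.map A' V)
    with hcdef
  refine ⟨c, ?_, ENNReal.coe_ne_top, fun G hG => ?_⟩
  · intro h0
    rw [ENNReal.coe_eq_zero] at h0
    rw [h0] at hc
    have : (volume : Measure E) ≠ 0 := NeZero.ne _
    exact this (by rw [hc]; simp)
  · conv_lhs => rw [hc]
    have e : (c • Measure.map A' V) = (c : ℝ≥0∞) • Measure.map A' V := rfl
    rw [e, lintegral_smul_measure, lintegral_map hG A'.continuous.measurable]
    rfl

lemma polar_plane (n : ℕ) (hnpos : 0 < n) (H : ℝ × ℝ → ℝ≥0∞) (hH : Measurable H) :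
    ∫⁻ y : ℝ, ∫⁻ ρ in Set.Ioi (0 : ℝ), ENNReal.ofReal (ρ ^ (n - 1)) * H (y, ρ) =
    ∫⁻ R in Set.Ioi (0 : ℝ), ∫⁻ t in Set.Ioo 0 Real.pi, ENNReal.ofReal (R ^ n) *
      (ENNReal.ofReal (Real.sin t ^ (n - 1)) * H (R * Real.cos t, R * Real.sin t)) := by
  set Q : ℝ × ℝ → ℝ≥0∞ := fun p => (Set.Ioi (0 : ℝ)).indicator (fun ρ =>
      ENNReal.ofReal (ρ ^ (n - 1)) * H (p.1, ρ)) p.2 with hQ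
  have hQ' : Q = (Prod.snd ⁻¹' (Set.Ioi (0 : ℝ))).indicator (fun p : ℝ × ℝ =>
      ENNReal.ofReal (p.2 ^ (n - 1)) * H p) := by
    ext p
    simp [hQ, Set.indicator]
  have hQm : Measurable Q := by
    rw [hQ']
    refine Measurable.indicator (Measurable.mul ?_ hH) (measurable_snd measurableSet_Ioi)
    exact ENNReal.measurable_ofReal.comp (measurable_snd.pow_const _)
  have e2 : ∫⁻ y : ℝ, ∫⁻ ρ in Set.Ioi (0 : ℝ),
        ENNReal.ofReal (ρ ^ (n - 1)) * H (y, ρ) = ∫⁻ p, Q p := by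
    rw [Measure.volume_eq_prod, lintegral_prod _ hQm.aemeasurable]
    refine lintegral_congr fun y => ?_
    rw [← lintegral_indicator measurableSet_Ioi]
  rw [e2, ← lintegral_comp_polarCoord_symm, polarCoord_target, Measure.volume_eq_prod,
      ← Measure.prod_restrict, lintegral_prod _ (by
        refine Measurable.aemeasurable ?_
        have := continuous_polarCoord_symm.measurable
        simp only [smul_eq_mul]
        exact Measurable.mul (ENNReal.measurable_ofReal.comp measurable_fst) (hQm.comp this))]
  refine setLIntegral_congr_fun measurableSet_Ioi fun R hR => ?_
  have hR : 0 < R := hR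
  rw [← lintegral_indicator measurableSet_Ioo, ← lintegral_indicator measurableSet_Ioo]
  refine lintegral_congr fun t => ?_
  by_cases ht : t ∈ Set.Ioo 0 Real.pi
  · have ht' : t ∈ Set.Ioo (-Real.pi) Real.pi := ⟨by linarith [ht.1, Real.pi_pos], ht.2⟩
    have hs : 0 < Real.sin t := Real.sin_pos_of_mem_Ioo ht
    rw [Set.indicator_of_mem ht, Set.indicator_of_mem ht']
    simp only [hQ, polarCoord_symm_apply]
    rw [Set.indicator_of_mem (by exact mul_pos hR hs)]
    rw [smul_eq_mul, ← mul_assoc, ← ENNReal.ofReal_mul hR.le, mul_pow]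
    have h3 : R * (R ^ (n - 1) * Real.sin t ^ (n - 1)) = R ^ n * Real.sin t ^ (n - 1) := by
      rw [← mul_assoc, mul_pow_sub_one hnpos.ne']
    rw [h3, ENNReal.ofReal_mul (by positivity), mul_assoc]
  · rw [Set.indicator_of_notMem ht]
    by_cases ht' : t ∈ Set.Ioo (-Real.pi) Real.pi
    · rw [Set.indicator_of_mem ht']
      have hs : Real.sin t ≤ 0 := by
        have : t ≤ 0 := by
          by_contra hcon
          exact ht ⟨not_le.1 hcon, ht'.2⟩
        exact Real.sin_nonpos_of_nonpos_of_neg_pi_le this ht'.1.le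
      simp only [hQ, polarCoord_symm_apply]
      rw [Set.indicator_of_notMem, smul_zero]
      simp only [Set.mem_Ioi, not_lt]
      exact mul_nonpos_of_nonneg_of_nonpos hR.le hs
    · rw [Set.indicator_of_notMem ht']

lemma polMap_meas2 {E F : Type*} [NormedAddCommGroup E] [InnerProductSpace ℝ E]
    [FiniteDimensional ℝ E] [MeasurableSpace E] [BorelSpace E]
    [NormedAddCommGroup F] [InnerProductSpace ℝ F]
    [FiniteDimensional ℝ F] [MeasurableSpace F] [BorelSpace F] (n : ℕ)
    (ζ : sphere (0 : E) 1) (L : F →ₗᵢ[ℝ] E)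
    (hL : ∀ z, ⟪(ζ : E), L z⟫ = 0) (h : sphere (0 : E) 1 → ℝ≥0∞) (hh : Measurable h) :
    Measurable (fun q : sphere (0 : F) 1 × ℝ =>
        ENNReal.ofReal (Real.sin q.2 ^ (n - 1)) * h (polMap ζ L hL q.2 q.1)) := by
  have hc : Continuous (fun q : sphere (0 : F) 1 × ℝ => polMap ζ L hL q.2 q.1) :=
    (polMap_cont ζ L hL).comp continuous_swap
  have hm : Measurable (fun q : sphere (0 : F) 1 × ℝ => polMap ζ L hL q.2 q.1) := hc.measurable
  refine Measurable.mul ?_ (hh.comp hm)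
  refine ENNReal.measurable_ofReal.comp (Continuous.measurable ?_)
  exact (Real.continuous_sin.comp continuous_snd).pow _

lemma polMap_meas3 {E F : Type*} [NormedAddCommGroup E] [InnerProductSpace ℝ E]
    [FiniteDimensional ℝ E] [MeasurableSpace E] [BorelSpace E]
    [NormedAddCommGroup F] [InnerProductSpace ℝ F] (n : ℕ)
    (ζ : sphere (0 : E) 1) (L : F →ₗᵢ[ℝ] E)
    (hL : ∀ z, ⟪(ζ : E), L z⟫ = 0) (h : sphere (0 : E) 1 → ℝ≥0∞) (hh : Measurable h)
    (ω : sphere (0 : F) 1) :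
    Measurable (fun t : ℝ =>
        ENNReal.ofReal (Real.sin t ^ (n - 1)) * h (polMap ζ L hL t ω)) := by
  have hc : Continuous (fun t : ℝ => polMap ζ L hL t ω) :=
    (polMap_cont ζ L hL).comp (continuous_id.prodMk continuous_const)
  refine Measurable.mul ?_ (hh.comp hc.measurable)
  refine ENNReal.measurable_ofReal.comp (Continuous.measurable ?_)
  exact Real.continuous_sin.pow _

set_option maxHeartbeats 1000000 in
lemma polar_sphere {E F : Type*} [NormedAddCommGroup E] [InnerProductSpace ℝ E]
    [FiniteDimensional ℝ E] [MeasurableSpace E] [BorelSpace E]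
    [NormedAddCommGroup F] [InnerProductSpace ℝ F]
    [FiniteDimensional ℝ F] [MeasurableSpace F] [BorelSpace F] [Nontrivial F]
    (ζ : sphere (0 : E) 1) (L : F →ₗᵢ[ℝ] E)
    (hL : ∀ z, ⟪(ζ : E), L z⟫ = 0) (hdim : Module.finrank ℝ E = Module.finrank ℝ F + 1) :
    ∃ c : ℝ≥0∞, c ≠ 0 ∧ c ≠ ∞ ∧ ∀ h : sphere (0 : E) 1 → ℝ≥0∞, Measurable h →
      ∫⁻ η, h η ∂((volume : Measure E).toSphere) = c * ∫⁻ ω, (∫⁻ t in Set.Ioo 0 Real.pi,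
        ENNReal.ofReal (Real.sin t ^ (Module.finrank ℝ F - 1)) * h (polMap ζ L hL t ω))
          ∂((volume : Measure F).toSphere) := by
  obtain ⟨c, hc0, hct, hc⟩ := haar_prod ζ L hL hdim
  have : Nontrivial E := L.injective.nontrivial
  refine ⟨c, hc0, hct, fun h hh => ?_⟩
  set n := Module.finrank ℝ F with hn
  have hnpos : 0 < n := Module.finrank_pos
  set w : ℝ → ℝ≥0∞ := (Set.Iio 1).indicator 1 with hw
  have hwm : Measurable w := measurable_one.indicator measurableSet_Iio
  have hmw : Measurable (fun R : ℝ => ENNReal.ofReal (R ^ n) * w R) :=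
    Measurable.mul (by fun_prop) hwm
  set W : ℝ≥0∞ := ∫⁻ R in Set.Ioi (0 : ℝ), ENNReal.ofReal (R ^ n) * w R with hW
  have hWe : W = ∫⁻ R in Set.Ioo (0 : ℝ) 1, ENNReal.ofReal (R ^ n) := by
    rw [hW, ← lintegral_indicator measurableSet_Ioi, ← lintegral_indicator measurableSet_Ioo]
    refine lintegral_congr fun R => ?_
    by_cases h1 : 0 < R <;> by_cases h2 : R < 1 <;> simp [hw, h1, h2]
  have hWt : W ≠ ∞ := by
    rw [hWe]
    have : ∫⁻ R in Set.Ioo (0 : ℝ) 1, ENNReal.ofReal (R ^ n) ≤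
        ∫⁻ R in Set.Ioo (0 : ℝ) 1, 1 := by
      refine setLIntegral_mono measurable_const fun R hR => ?_
      rw [ENNReal.ofReal_le_one]
      exact pow_le_one₀ hR.1.le hR.2.le
    refine (this.trans_lt ?_).ne
    simp
  have hW0 : W ≠ 0 := by
    rw [hWe]
    refine ((setLIntegral_pos_iff (by fun_prop)).2 ?_).ne'
    refine lt_of_lt_of_le (b := volume (Set.Ioo (0 : ℝ) 1)) (by simp) (measure_mono ?_)
    intro R hR
    refine ⟨?_, hR⟩
    simp only [Function.mem_support]
    have := pow_pos hR.1 n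
    simpa using this
  set G : E → ℝ≥0∞ := fun x => w ‖x‖ * h (radProj ζ x) with hGd
  have hGm : Measurable G :=
    (hwm.comp measurable_norm).mul (hh.comp (radProj_meas ζ))
  have hG : ∀ (u : sphere (0 : E) 1) (R : ℝ), 0 < R → G (R • (u : E)) = w R * h u := by
    intro u R hR
    simp only [hGd]
    rw [radProj_smul ζ u hR, norm_smul, norm_eq_of_mem_sphere, mul_one, Real.norm_of_nonneg hR.le]
  -- first computation
  have s1 : ∫⁻ x, G x = W * ∫⁻ η, h η ∂((volume : Measure E).toSphere) := by
    rw [lint_polar G hGm, hdim, Nat.add_sub_cancel, ← lintegral_const_mul _ hh]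
    refine lintegral_congr fun ω => ?_
    rw [hW, ← lintegral_mul_const _ hmw]
    refine setLIntegral_congr_fun measurableSet_Ioi fun R hR => ?_
    rw [hG ω R hR, mul_assoc]
  have hLc := L.continuous
  -- second computation
  have s2 : ∫⁻ p : ℝ × F, G (p.1 • (ζ : E) + L p.2) = W * ∫⁻ ω, (∫⁻ t in Set.Ioo 0 Real.pi,
        ENNReal.ofReal (Real.sin t ^ (n - 1)) * h (polMap ζ L hL t ω))
          ∂((volume : Measure F).toSphere) := by
    have hpm : Measurable (fun p : ℝ × sphere (0 : F) 1 => polMap ζ L hL p.1 p.2) :=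
      (polMap_cont ζ L hL).measurable
    have hms := polMap_meas2 n ζ L hL h hh
    have hm1 : Measurable (fun p : ℝ × F => G (p.1 • (ζ : E) + L p.2)) := by
      refine hGm.comp (Continuous.measurable ?_)
      fun_prop
    rw [Measure.volume_eq_prod, lintegral_prod _ hm1.aemeasurable]
    have e1 : ∀ y : ℝ, ∫⁻ z : F, G (y • (ζ : E) + L z) = ∫⁻ ω, (∫⁻ ρ in Set.Ioi (0 : ℝ),
      ENNReal.ofReal (ρ ^ (n - 1)) * G (y • (ζ : E) + L (ρ • (ω : F))))
        ∂((volume : Measure F).toSphere) := fun y => lint_polar _ (hm1.comp (by fun_prop : Measurable (fun z : F => (y, z))))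
    simp only [e1]
    rw [lintegral_lintegral_swap]
    swap
    · refine Measurable.aemeasurable ?_
      refine Measurable.lintegral_prod_right' (f := fun q : (ℝ × sphere (0 : F) 1) × ℝ =>
        ENNReal.ofReal (q.2 ^ (n - 1)) * G (q.1.1 • (ζ : E) + L (q.2 • (q.1.2 : F)))) ?_
      refine Measurable.mul (by fun_prop) (hGm.comp (Continuous.measurable ?_))
      fun_prop
    rw [← lintegral_const_mul _ ?_]
    swap
    · refine Measurable.lintegral_prod_right' (f := fun q : sphere (0 : F) 1 × ℝ =>
        ENNReal.ofReal (Real.sin q.2 ^ (n - 1)) * h (polMap ζ L hL q.2 q.1)) ?_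
      exact hms
    refine lintegral_congr fun ω => ?_
    have hGω : Measurable (fun p : ℝ × ℝ => G (p.1 • (ζ : E) + L (p.2 • (ω : F)))) := by
      refine hGm.comp (Continuous.measurable ?_)
      fun_prop
    rw [polar_plane n hnpos (fun p : ℝ × ℝ => G (p.1 • (ζ : E) + L (p.2 • (ω : F)))) hGω]
    rw [hW, ← lintegral_mul_const _ (hmw)]
    refine setLIntegral_congr_fun measurableSet_Ioi fun R hR => ?_
    have hR : 0 < R := hR
    beta_reduce
    have hmt : Measurable (fun t : ℝ =>
        ENNReal.ofReal (Real.sin t ^ (n - 1)) * h (polMap ζ L hL t ω)) :=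
      polMap_meas3 n ζ L hL h hh ω
    rw [← lintegral_const_mul _ hmt]
    refine lintegral_congr fun t => ?_
    have : (R * Real.cos t) • (ζ : E) + L ((R * Real.sin t) • (ω : F)) =
          R • ((polMap ζ L hL t ω : sphere (0 : E) 1) : E) := by
      simp only [polMap, map_smul, smul_add, smul_smul]
    rw [this, hG _ R hR]
    ring
  have s3 := hc G hGm
  rw [s1, s2, ← mul_assoc, mul_comm c W, mul_assoc] at s3
  exact (ENNReal.mul_right_inj hW0 hWt).1 s3

end

section


lemma exists_frame (d : ℕ) (ζ : Sph d) : ∃ L : Euc d →ₗᵢ[ℝ] Euc (d + 1),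
    (∀ z, ⟪(ζ : Euc (d + 1)), L z⟫ = 0) ∧ ∀ x, ⟪(ζ : Euc (d + 1)), x⟫ = 0 → ∃ z, L z = x := by
  have hz : (ζ : Euc (d + 1)) ≠ 0 := by
    intro h
    have := norm_eq_of_mem_sphere ζ
    rw [h] at this; simp at this
  have : Fact (Module.finrank ℝ (Euc (d + 1)) = d + 1) := ⟨by simp⟩
  let b := OrthonormalBasis.fromOrthogonalSpanSingleton (𝕜 := ℝ) d hz
  refine ⟨(Submodule.subtypeₗᵢ _).comp b.repr.symm.toLinearIsometry, fun z => ?_, fun x hx => ?_⟩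
  · exact Submodule.mem_orthogonal_singleton_iff_inner_right.1 (b.repr.symm z).2
  · refine ⟨b.repr ⟨x, Submodule.mem_orthogonal_singleton_iff_inner_right.2 hx⟩, ?_⟩
    simp

lemma geodist_polMap {d : ℕ} (ζ : Sph d) (L : Euc d →ₗᵢ[ℝ] Euc (d + 1))
    (hL : ∀ z, ⟪(ζ : Euc (d + 1)), L z⟫ = 0) {t : ℝ} (ht : t ∈ Set.Icc 0 Real.pi)
    (ω : sphere (0 : Euc d) 1) : geodist ζ (polMap ζ L hL t ω) = t := by
  unfold geodist polMap
  simp only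
  rw [inner_add_right, inner_smul_right, inner_smul_right, hL, real_inner_self_eq_norm_sq,
    norm_eq_of_mem_sphere]
  simp only [one_pow, mul_one, mul_zero, add_zero]
  exact Real.arccos_cos ht.1 ht.2

lemma geodist_cont {d : ℕ} (ζ : Sph d) : Continuous (fun η : Sph d => geodist ζ η) := by
  unfold geodist
  exact Real.continuous_arccos.comp (continuous_const.inner continuous_subtype_val)

lemma sphMeasure_eq (d : ℕ) : ∃ c : ℝ≥0∞, c ≠ 0 ∧ c ≠ ∞ ∧
    sphMeasure d = c • (volume : Measure (Euc (d + 1))).toSphere :=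
  hausSph_eq (E := Euc (d + 1)) d (by simp)

instance sphMeasure_finite (d : ℕ) : IsFiniteMeasure (sphMeasure d) := by
  obtain ⟨c, _, hct, h⟩ := sphMeasure_eq d
  rw [h]
  constructor
  rw [Measure.smul_apply, smul_eq_mul]
  exact ENNReal.mul_lt_top hct.lt_top (measure_lt_top _ _)

/-- normalised polar measure -/
def radM (d : ℕ) : Measure ℝ :=
  (volume.restrict (Set.Ioo 0 Real.pi)).withDensity (fun t => ENNReal.ofReal (Real.sin t ^ (d - 1)))

instance radM_finite (d : ℕ) : IsFiniteMeasure (radM d) := by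
  unfold radM
  apply isFiniteMeasure_withDensity_ofReal
  have : IsFiniteMeasure (volume.restrict (Set.Ioo 0 Real.pi)) := ⟨by simp⟩
  refine HasFiniteIntegral.of_bounded (C := 1) (ae_of_all _ fun t => ?_)
  rw [norm_pow]
  exact pow_le_one₀ (norm_nonneg _) (Real.abs_sin_le_one t)

lemma polar_measure (d : ℕ) (hd : 1 ≤ d) (ζ : Sph d) (L : Euc d →ₗᵢ[ℝ] Euc (d + 1))
    (hL : ∀ z, ⟪(ζ : Euc (d + 1)), L z⟫ = 0) : ∃ c : ℝ≥0∞, c ≠ 0 ∧ c ≠ ∞ ∧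
    sphMeasure d = c • Measure.map (fun p : ℝ × sphere (0 : Euc d) 1 => polMap ζ L hL p.1 p.2)
      ((radM d).prod (volume : Measure (Euc d)).toSphere) := by
  have : Nonempty (Fin d) := ⟨⟨0, hd⟩⟩
  obtain ⟨c, hc0, hct, h⟩ := sphMeasure_eq d
  obtain ⟨c', hc0', hct', h'⟩ := polar_sphere ζ L hL (by simp)
  refine ⟨c * c', mul_ne_zero hc0 hc0', ENNReal.mul_ne_top hct hct', ?_⟩
  have hm : Measurable (fun p : ℝ × sphere (0 : Euc d) 1 => polMap ζ L hL p.1 p.2) :=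
    (polMap_cont ζ L hL).measurable
  ext s hs
  have h1 := h' (s.indicator 1) (measurable_one.indicator hs)
  rw [lintegral_indicator_one hs] at h1
  rw [h, Measure.smul_apply, Measure.smul_apply, smul_eq_mul, smul_eq_mul, h1, mul_assoc,
    Measure.map_apply hm hs, Measure.prod_apply_symm (hm hs)]
  congr 2
  refine lintegral_congr fun ω => ?_
  have hmω : Measurable (fun t : ℝ => polMap ζ L hL t ω) :=
    ((polMap_cont ζ L hL).comp (continuous_id.prodMk continuous_const)).measurable
  have hs2 : MeasurableSet ((fun t : ℝ => polMap ζ L hL t ω) ⁻¹' s) := hmω hs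
  have e : ((fun x => (x, ω)) ⁻¹' ((fun p : ℝ × sphere (0 : Euc d) 1 => polMap ζ L hL p.1 p.2) ⁻¹' s))
    = (fun t : ℝ => polMap ζ L hL t ω) ⁻¹' s := rfl
  rw [e, radM, withDensity_apply _ hs2, ← lintegral_indicator hs2]
  refine lintegral_congr fun t => ?_
  by_cases htm : polMap ζ L hL t ω ∈ s
  · rw [Set.indicator_of_mem htm, Set.indicator_of_mem (by exact htm)]
    simp
  · rw [Set.indicator_of_notMem htm, Set.indicator_of_notMem (by exact htm)]
    simp

/-- spherical mean (unnormalised) -/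
def sMean {d : ℕ} (ζ : Sph d) (L : Euc d →ₗᵢ[ℝ] Euc (d + 1))
    (hL : ∀ z, ⟪(ζ : Euc (d + 1)), L z⟫ = 0) (f : Sph d → ℝ) (t : ℝ) : ℝ :=
  ∫ ω, f (polMap ζ L hL t ω) ∂(volume : Measure (Euc d)).toSphere

lemma sMean_cont {d : ℕ} (ζ : Sph d) (L : Euc d →ₗᵢ[ℝ] Euc (d + 1))
    (hL : ∀ z, ⟪(ζ : Euc (d + 1)), L z⟫ = 0) (f : Sph d → ℝ) (hf : Continuous f) :
    Continuous (sMean ζ L hL f) := by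
  unfold sMean
  have h1 : Continuous (Function.uncurry fun (t : ℝ) (ω : sphere (0 : Euc d) 1) =>
    f (polMap ζ L hL t ω)) := hf.comp (polMap_cont ζ L hL)
  simpa using continuous_parametric_integral_of_continuous (μ := (volume : Measure (Euc d)).toSphere) h1 isCompact_univ

lemma sph_bdd {d : ℕ} (f : Sph d → ℝ) (hf : Continuous f) : ∃ C, 0 ≤ C ∧ ∀ x, |f x| ≤ C := by
  obtain ⟨C, hC⟩ := isCompact_univ.exists_bound_of_continuousOn hf.continuousOn
  refine ⟨max C 0, le_max_right _ _, fun x => ?_⟩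
  exact (hC x trivial).trans (le_max_left _ _)

lemma polar_formula (d : ℕ) (hd : 1 ≤ d) (ζ : Sph d) (L : Euc d →ₗᵢ[ℝ] Euc (d + 1))
    (hL : ∀ z, ⟪(ζ : Euc (d + 1)), L z⟫ = 0) : ∃ c : ℝ, 0 < c ∧
    ∀ (f : Sph d → ℝ) (k : ℝ → ℝ), Continuous f → Measurable k → (∃ C, ∀ t, |k t| ≤ C) →
      Integrable (fun η => k (geodist ζ η) * f η) (sphMeasure d) ∧
      ∫ η, k (geodist ζ η) * f η ∂(sphMeasure d) =
        c * ∫ t in Set.Ioo 0 Real.pi, k t * (sMean ζ L hL f t * Real.sin t ^ (d - 1)) := by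
  obtain ⟨c, hc0, hct, h⟩ := polar_measure d hd ζ L hL
  refine ⟨c.toReal, ENNReal.toReal_pos hc0 hct, fun f k hf hk ⟨C, hC⟩ => ?_⟩
  have hm : Measurable (fun p : ℝ × sphere (0 : Euc d) 1 => polMap ζ L hL p.1 p.2) :=
    (polMap_cont ζ L hL).measurable
  have hg : Measurable (fun η => k (geodist ζ η) * f η) :=
    (hk.comp (geodist_cont ζ).measurable).mul hf.measurable
  obtain ⟨C', hC'0, hC'⟩ := sph_bdd f hf
  have hb : ∀ η, ‖k (geodist ζ η) * f η‖ ≤ C * C' := fun η => by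
    rw [norm_mul]
    exact mul_le_mul (hC _) (hC' _) (norm_nonneg _) ((abs_nonneg _).trans (hC 0))
  refine ⟨Integrable.of_bound hg.aestronglyMeasurable (C * C') (ae_of_all _ hb), ?_⟩
  rw [h, integral_smul_measure, integral_map hm.aemeasurable hg.aestronglyMeasurable, smul_eq_mul]
  congr 1
  rw [integral_prod]
  swap
  · exact Integrable.of_bound (hg.comp hm).aestronglyMeasurable (C * C') (ae_of_all _ fun p => hb _)
  have hdm : Measurable (fun t : ℝ => ENNReal.ofReal (Real.sin t ^ (d - 1))) := by fun_prop
  rw [radM, integral_withDensity_eq_integral_toReal_smul hdm (ae_of_all _ fun _ => ENNReal.ofReal_lt_top)]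
  refine setIntegral_congr_fun measurableSet_Ioo fun t ht => ?_
  have hs : 0 < Real.sin t := Real.sin_pos_of_mem_Ioo ht
  have ht' : t ∈ Set.Icc 0 Real.pi := ⟨ht.1.le, ht.2.le⟩
  simp only [geodist_polMap ζ L hL ht']
  rw [ENNReal.toReal_ofReal (by positivity), integral_const_mul, smul_eq_mul, sMean]
  ring

end

section
open scoped ENNReal RealInnerProductSpace NNReal Pointwise

lemma polMap_inj {d : ℕ} (ζ : Sph d) (L : Euc d →ₗᵢ[ℝ] Euc (d + 1))
    (hL : ∀ z, ⟪(ζ : Euc (d + 1)), L z⟫ = 0) {r : ℝ} (hr : Real.sin r ≠ 0) :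
    Function.Injective (polMap ζ L hL r) := by
  intro a b h
  have h1 := congrArg Subtype.val h
  simp only [polMap, add_right_inj] at h1
  exact Subtype.ext (L.injective (smul_right_injective _ hr h1))

lemma polMap_range {d : ℕ} (ζ : Sph d) (L : Euc d →ₗᵢ[ℝ] Euc (d + 1))
    (hL : ∀ z, ⟪(ζ : Euc (d + 1)), L z⟫ = 0)
    (hL2 : ∀ x, ⟪(ζ : Euc (d + 1)), x⟫ = 0 → ∃ z, L z = x) {r : ℝ} (h0 : 0 < r) (h1 : r < Real.pi) :
    Set.range (polMap ζ L hL r) = gsphere ζ r := by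
  have hs : 0 < Real.sin r := Real.sin_pos_of_mem_Ioo ⟨h0, h1⟩
  have nz : ‖(ζ : Euc (d + 1))‖ = 1 := norm_eq_of_mem_sphere ζ
  ext η
  have nη : ‖(η : Euc (d + 1))‖ = 1 := norm_eq_of_mem_sphere η
  constructor
  · rintro ⟨ω, rfl⟩
    exact geodist_polMap ζ L hL ⟨h0.le, h1.le⟩ ω
  · intro hη
    have hη : geodist ζ η = r := hη
    have hc : ⟪(ζ : Euc (d + 1)), (η : Euc (d + 1))⟫ = Real.cos r := by
      rw [← hη, geodist, Real.cos_arccos]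
      · have := abs_real_inner_le_norm (ζ : Euc (d + 1)) (η : Euc (d + 1))
        rw [nz, nη] at this
        linarith [(abs_le.1 this).1]
      · have := abs_real_inner_le_norm (ζ : Euc (d + 1)) (η : Euc (d + 1))
        rw [nz, nη] at this
        linarith [(abs_le.1 this).2]
    obtain ⟨z, hz⟩ := hL2 ((η : Euc (d + 1)) - Real.cos r • (ζ : Euc (d + 1))) (by
      rw [inner_sub_right, inner_smul_right, real_inner_self_eq_norm_sq, nz, hc]; ring)
    have hzn : ‖z‖ = Real.sin r := by
      have e : ‖z‖ ^ 2 = Real.sin r ^ 2 := by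
        rw [← L.norm_map, hz, norm_sub_sq_real, inner_smul_right, real_inner_comm, hc, norm_smul, nz, nη,
          Real.norm_eq_abs, mul_one, sq_abs]
        linarith [Real.sin_sq_add_cos_sq r]
      exact (pow_left_inj₀ (norm_nonneg _) hs.le two_ne_zero).1 e
    refine ⟨⟨(Real.sin r)⁻¹ • z, ?_⟩, ?_⟩
    · rw [mem_sphere_zero_iff_norm, norm_smul, hzn, norm_inv, Real.norm_of_nonneg hs.le,
        inv_mul_cancel₀ hs.ne']
    · apply Subtype.ext
      simp only [polMap, map_smul, smul_smul, mul_inv_cancel₀ hs.ne', one_smul, hz]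
      abel

lemma polMap_contr {d : ℕ} (ζ : Sph d) (L : Euc d →ₗᵢ[ℝ] Euc (d + 1))
    (hL : ∀ z, ⟪(ζ : Euc (d + 1)), L z⟫ = 0) (r : ℝ) : Continuous (polMap ζ L hL r) := by
  refine Continuous.subtype_mk ?_ _
  have := L.continuous
  fun_prop

lemma bdry_restrict (d : ℕ) (hd : 1 ≤ d) (ζ : Sph d) (L : Euc d →ₗᵢ[ℝ] Euc (d + 1))
    (hL : ∀ z, ⟪(ζ : Euc (d + 1)), L z⟫ = 0)
    (hL2 : ∀ x, ⟪(ζ : Euc (d + 1)), x⟫ = 0 → ∃ z, L z = x) {r : ℝ} (h0 : 0 < r) (h1 : r < Real.pi) :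
    ∃ c : ℝ≥0∞, c ≠ 0 ∧ c ≠ ∞ ∧ (sphBdry d).restrict (gsphere ζ r) =
      c • Measure.map (polMap ζ L hL r) (volume : Measure (Euc d)).toSphere := by
  have hs : 0 < Real.sin r := Real.sin_pos_of_mem_Ioo ⟨h0, h1⟩
  obtain ⟨c, hc0, hct, hc⟩ := hausSph_eq (E := Euc d) (d - 1) (by simp; omega)
  have hcast : ((d - 1 : ℕ) : ℝ) = (d : ℝ) - 1 := by rw [Nat.cast_sub hd]; simp
  rw [hcast] at hc
  have hd0 : (0 : ℝ) ≤ (d : ℝ) - 1 := by rw [← hcast]; positivity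
  set C : ℝ≥0 := ‖Real.sin r‖₊ ^ ((d : ℝ) - 1) with hC
  have hCpos : C ≠ 0 := by
    rw [hC]
    exact (NNReal.rpow_pos (by simpa using hs.ne')).ne'
  refine ⟨C * c, mul_ne_zero (by simpa using hCpos) hc0, ENNReal.mul_ne_top ENNReal.coe_ne_top hct, ?_⟩
  ext s hsm
  rw [Measure.restrict_apply hsm, ← polMap_range ζ L hL hL2 h0 h1, Measure.smul_apply,
    Measure.map_apply (polMap_contr ζ L hL r).measurable hsm, ← Set.image_preimage_eq_inter_range]
  set A := polMap ζ L hL r ⁻¹' s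
  have e1 : sphBdry d (polMap ζ L hL r '' A) =
      Measure.hausdorffMeasure ((d : ℝ) - 1) (Subtype.val '' (polMap ζ L hL r '' A)) :=
    hausSph_apply _ _
  have e2 : Subtype.val '' (polMap ζ L hL r '' A) =
      (fun x => Real.cos r • (ζ : Euc (d + 1)) + L x) '' (Real.sin r • (Subtype.val '' A)) := by
    rw [← Set.image_smul, Set.image_image, Set.image_image, Set.image_image]
    simp only [polMap, map_smul]
  have hiso : Isometry (fun x => Real.cos r • (ζ : Euc (d + 1)) + L x) :=
    (IsometryEquiv.addLeft (Real.cos r • (ζ : Euc (d + 1)))).isometry.comp L.isometry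
  have e3 : Measure.hausdorffMeasure ((d : ℝ) - 1) (Subtype.val '' A) = hausSph (Euc d) ((d : ℝ) - 1) A :=
    (hausSph_apply _ _).symm
  rw [e1, e2, hiso.hausdorffMeasure_image (Or.inl hd0), Measure.hausdorffMeasure_smul₀ hd0 hs.ne',
    e3, hc, Measure.smul_apply, smul_eq_mul, smul_eq_mul, mul_assoc]
  rfl

lemma bdry_avg (d : ℕ) (hd : 1 ≤ d) (ζ : Sph d) (L : Euc d →ₗᵢ[ℝ] Euc (d + 1))
    (hL : ∀ z, ⟪(ζ : Euc (d + 1)), L z⟫ = 0)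
    (hL2 : ∀ x, ⟪(ζ : Euc (d + 1)), x⟫ = 0 → ∃ z, L z = x) {r : ℝ} (h0 : 0 < r) (h1 : r < Real.pi)
    (f : Sph d → ℝ) (hf : Continuous f) :
    ⨍ η in gsphere ζ r, f η ∂(sphBdry d) =
      sMean ζ L hL f r / (volume : Measure (Euc d)).toSphere.real Set.univ := by
  obtain ⟨c, hc0, hct, hc⟩ := bdry_restrict d hd ζ L hL hL2 h0 h1
  have hm := (polMap_contr ζ L hL r).measurable
  rw [average_eq, hc, integral_smul_measure, integral_map hm.aemeasurable hf.aestronglyMeasurable,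
    measureReal_ennreal_smul_apply, map_measureReal_apply hm MeasurableSet.univ, Set.preimage_univ]
  have : c.toReal ≠ 0 := (ENNReal.toReal_pos hc0 hct).ne'
  rw [smul_eq_mul, smul_eq_mul, mul_inv, sMean]
  field_simp

end

section


lemma sinInt_hasDerivAt (d : ℕ) (t : ℝ) : HasDerivAt (sinInt d) (Real.sin t ^ (d - 1)) t := by
  have hc : Continuous (fun t : ℝ => Real.sin t ^ (d - 1)) := by fun_prop
  exact intervalIntegral.integral_hasDerivAt_right (hc.intervalIntegrable _ _)
    (hc.stronglyMeasurableAtFilter _ _) hc.continuousAt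

lemma sinInt_contDiff (d : ℕ) : ContDiff ℝ (⊤ : ℕ∞) (sinInt d) := by
  rw [contDiff_infty_iff_deriv]
  refine ⟨fun t => (sinInt_hasDerivAt d t).differentiableAt, ?_⟩
  have : deriv (sinInt d) = fun t => Real.sin t ^ (d - 1) :=
    funext fun t => (sinInt_hasDerivAt d t).deriv
  rw [this]
  exact Real.contDiff_sin.pow _

/-- test profile -/
def tprof (d : ℕ) (w : ℝ → ℝ) (s : ℝ) : ℝ :=
  w (Real.arccos s) * sinInt d (Real.arccos s) / Real.sin (Real.arccos s) ^ d

lemma tprof_smooth (d : ℕ) (w : ℝ → ℝ) (hw : ContDiff ℝ (⊤ : ℕ∞) w) {a b : ℝ} (ha : 0 < a)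
    (hb : b < Real.pi) (h1 : ∀ t ≤ a, w t = 0) (h2 : ∀ t, b ≤ t → w t = 0) :
    ContDiff ℝ (⊤ : ℕ∞) (tprof d w) := by
  rw [contDiff_iff_contDiffAt]
  intro s
  by_cases hs : |s| < 1
  · have hs' := abs_lt.1 hs
    have hA : ContDiffAt ℝ (⊤ : ℕ∞) Real.arccos s :=
      Real.contDiffAt_arccos (by linarith) (by linarith)
    unfold tprof
    refine ContDiffAt.div ?_ ?_ ?_
    · exact (hw.contDiffAt.comp s hA).mul ((sinInt_contDiff d).contDiffAt.comp s hA)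
    · exact (Real.contDiff_sin.contDiffAt.comp s hA).pow _
    · rw [Real.sin_arccos]
      have : 0 < 1 - s ^ 2 := by nlinarith
      positivity
  · have hz : tprof d w =ᶠ[𝓝 s] fun _ => 0 := by
      have hcont := Real.continuous_arccos.continuousAt (x := s)
      rcases le_or_gt 1 s with h | h
      · have h0 : Real.arccos s = 0 := Real.arccos_eq_zero.2 h
        have : ∀ᶠ x in 𝓝 s, Real.arccos x < a := by
          apply hcont.eventually_lt_const
          rw [h0]; exact ha
        filter_upwards [this] with x hx
        simp [tprof, h1 _ hx.le]
      · have hs2 : s ≤ -1 := by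
          by_contra hcon
          exact hs (abs_lt.2 ⟨by linarith, h⟩)
        have h0 : Real.arccos s = Real.pi := Real.arccos_eq_pi.2 hs2
        have : ∀ᶠ x in 𝓝 s, b < Real.arccos x := by
          apply hcont.eventually_const_lt
          rw [h0]; exact hb
        filter_upwards [this] with x hx
        simp [tprof, h2 _ hx.le]
    exact contDiffAt_const.congr_of_eventuallyEq hz

lemma geodist_cos {d : ℕ} (ζ η : Sph d) :
    Real.cos (geodist ζ η) = ⟪(ζ : Euc (d + 1)), (η : Euc (d + 1))⟫ := by
  have := abs_real_inner_le_norm (ζ : Euc (d + 1)) (η : Euc (d + 1))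
  rw [norm_eq_of_mem_sphere, norm_eq_of_mem_sphere, one_mul] at this
  rw [geodist, Real.cos_arccos (abs_le.1 this).1 (abs_le.1 this).2]

lemma geodist_mem {d : ℕ} (ζ η : Sph d) : geodist ζ η ∈ Set.Icc 0 Real.pi :=
  ⟨Real.arccos_nonneg _, Real.arccos_le_pi _⟩

lemma grad_inner_comp {d : ℕ} (ζ : Sph d) (ψ : ℝ → ℝ) (hψ : ContDiff ℝ (⊤ : ℕ∞) ψ)
    (x : Euc (d + 1)) :
    gradient (fun x : Euc (d + 1) => ψ ⟪(ζ : Euc (d + 1)), x⟫) x =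
      deriv ψ ⟪(ζ : Euc (d + 1)), x⟫ • (ζ : Euc (d + 1)) := by
  apply HasGradientAt.gradient
  rw [hasGradientAt_iff_hasFDerivAt]
  have h1 : HasFDerivAt (fun x : Euc (d + 1) => ⟪(ζ : Euc (d + 1)), x⟫)
    (innerSL ℝ (ζ : Euc (d + 1))) x := (innerSL ℝ (ζ : Euc (d + 1))).hasFDerivAt
  have h2 : HasDerivAt ψ (deriv ψ ⟪(ζ : Euc (d + 1)), x⟫) ⟪(ζ : Euc (d + 1)), x⟫ :=
    ((hψ.differentiable (by simp)) _).hasDerivAt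
  refine (h2.comp_hasFDerivAt x h1).congr_fderiv ?_
  ext y
  simp [inner_smul_left]

lemma weak_test {d : ℕ} (ζ : Sph d) (f : Sph d → ℝ) (g : Sph d → Euc (d + 1))
    (hf : MemW11 f g) (hfc : Continuous f) (ψ : ℝ → ℝ) (hψ : ContDiff ℝ (⊤ : ℕ∞) ψ) :
    ∫ η, ψ (Real.cos (geodist ζ η)) * ⟪g η, (ζ : Euc (d + 1))⟫ ∂(sphMeasure d) =
      ∫ η, (- (deriv ψ (Real.cos (geodist ζ η)) * Real.sin (geodist ζ η) ^ 2) +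
        d * (ψ (Real.cos (geodist ζ η)) * Real.cos (geodist ζ η))) * f η ∂(sphMeasure d) := by
  obtain ⟨hfi, hgi, -, hw⟩ := hf
  have hφ : ContDiff ℝ (⊤ : ℕ∞) (fun x : Euc (d + 1) => ψ ⟪(ζ : Euc (d + 1)), x⟫) :=
    hψ.comp (contDiff_const.inner ℝ contDiff_id)
  have h := congrArg (fun v => ⟪(ζ : Euc (d + 1)), v⟫) (hw _ hφ)
  have nz : ‖(ζ : Euc (d + 1))‖ = 1 := norm_eq_of_mem_sphere ζ
  simp only [grad_inner_comp ζ ψ hψ] at h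
  have hψc : Continuous ψ := hψ.continuous
  have hψ'c : Continuous (deriv ψ) := hψ.continuous_deriv (by simp)
  have hic : Continuous (fun η : Sph d => ⟪(ζ : Euc (d + 1)), (η : Euc (d + 1))⟫) :=
    continuous_const.inner continuous_subtype_val
  have ic : ∀ F : Sph d → Euc (d + 1), Continuous F → Integrable F (sphMeasure d) := by
    intro F hF
    obtain ⟨C, hC⟩ := isCompact_univ.exists_bound_of_continuousOn hF.continuousOn
    exact Integrable.of_bound hF.aestronglyMeasurable C (ae_of_all _ fun x => hC x trivial)
  have ic' : ∀ F : Sph d → ℝ, Continuous F → Integrable F (sphMeasure d) := by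
    intro F hF
    obtain ⟨C, hC⟩ := isCompact_univ.exists_bound_of_continuousOn hF.continuousOn
    exact Integrable.of_bound hF.aestronglyMeasurable C (ae_of_all _ fun x => hC x trivial)
  have i1 : Integrable (fun η : Sph d => ψ ⟪(ζ : Euc (d + 1)), (η : Euc (d + 1))⟫ • g η) (sphMeasure d) := by
    obtain ⟨C, hC⟩ := isCompact_univ.exists_bound_of_continuousOn (hψc.comp hic).continuousOn
    exact hgi.bdd_smul C (hψc.comp hic).aestronglyMeasurable (ae_of_all _ fun x => hC x trivial)
  have c2 : Continuous (fun η : Sph d => f η • tangProj η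
      (deriv ψ ⟪(ζ : Euc (d + 1)), (η : Euc (d + 1))⟫ • (ζ : Euc (d + 1)))) := by
    unfold tangProj
    fun_prop
  have c3 : Continuous (fun η : Sph d => (f η * ψ ⟪(ζ : Euc (d + 1)), (η : Euc (d + 1))⟫) •
      (η : Euc (d + 1))) := by fun_prop
  rw [inner_add_right, inner_neg_right, inner_smul_right, ← integral_inner i1,
    ← integral_inner (ic _ c2), ← integral_inner (ic _ c3)] at h
  have e1 : ∀ η : Sph d, ψ (Real.cos (geodist ζ η)) * ⟪g η, (ζ : Euc (d + 1))⟫ =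
      ⟪(ζ : Euc (d + 1)), ψ ⟪(ζ : Euc (d + 1)), (η : Euc (d + 1))⟫ • g η⟫ := by
    intro η
    rw [geodist_cos, inner_smul_right, real_inner_comm (ζ : Euc (d + 1)) (g η)]
  simp only [e1]
  rw [h, ← integral_neg, ← integral_const_mul, ← integral_add]
  · refine integral_congr_ae (ae_of_all _ fun η => ?_)
    simp only [tangProj]
    rw [inner_smul_right, inner_smul_right, inner_sub_right, inner_smul_right, inner_smul_right,
      real_inner_self_eq_norm_sq, nz, inner_smul_left, Real.sin_sq, geodist_cos]
    simp only [conj_trivial]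
    ring
  · refine (ic' _ ?_).neg
    exact continuous_const.inner c2
  · refine (ic' _ ?_).const_mul _
    exact continuous_const.inner c3

lemma weak_polar (d : ℕ) (hd : 1 ≤ d) (ζ : Sph d) (L : Euc d →ₗᵢ[ℝ] Euc (d + 1))
    (hL : ∀ z, ⟪(ζ : Euc (d + 1)), L z⟫ = 0) (c : ℝ)
    (hc : ∀ (f : Sph d → ℝ) (k : ℝ → ℝ), Continuous f → Measurable k → (∃ C, ∀ t, |k t| ≤ C) →
      Integrable (fun η => k (geodist ζ η) * f η) (sphMeasure d) ∧
      ∫ η, k (geodist ζ η) * f η ∂(sphMeasure d) =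
        c * ∫ t in Set.Ioo 0 Real.pi, k t * (sMean ζ L hL f t * Real.sin t ^ (d - 1)))
    (f : Sph d → ℝ) (g : Sph d → Euc (d + 1))
    (hf : MemW11 f g) (hfc : Continuous f)
    (w : ℝ → ℝ) (hw : ContDiff ℝ (⊤ : ℕ∞) w) {a b : ℝ} (ha : 0 < a)
    (hb : b < Real.pi) (h1 : ∀ t ≤ a, w t = 0) (h2 : ∀ t, b ≤ t → w t = 0) :
    ∫ η, w (geodist ζ η) * sinInt d (geodist ζ η) / Real.sin (geodist ζ η) ^ d *
        ⟪g η, (ζ : Euc (d + 1))⟫ ∂(sphMeasure d) =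
      c * ∫ t in Set.Ioo 0 Real.pi, sMean ζ L hL f t *
        (deriv w t * sinInt d t + w t * Real.sin t ^ (d - 1)) := by
  have hψ := tprof_smooth d w hw ha hb h1 h2
  have hA : ∀ t ∈ Set.Icc 0 Real.pi, Real.arccos (Real.cos t) = t :=
    fun t ht => Real.arccos_cos ht.1 ht.2
  have h := weak_test ζ f g hf hfc _ hψ
  have hψc : Continuous (tprof d w) := hψ.continuous
  have hψ'c : Continuous (deriv (tprof d w)) := hψ.continuous_deriv (by simp)
  have hψb : ∃ C, ∀ s ∈ Set.Icc (-1:ℝ) 1, ‖tprof d w s‖ ≤ C :=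
    isCompact_Icc.exists_bound_of_continuousOn hψc.continuousOn
  have hψ'b : ∃ C, ∀ s ∈ Set.Icc (-1:ℝ) 1, ‖deriv (tprof d w) s‖ ≤ C :=
    isCompact_Icc.exists_bound_of_continuousOn hψ'c.continuousOn
  obtain ⟨C1, hC1⟩ := hψb
  obtain ⟨C2, hC2⟩ := hψ'b
  have key := (hc f (fun t => - (deriv (tprof d w) (Real.cos t) * Real.sin t ^ 2) +
        d * (tprof d w (Real.cos t) * Real.cos t)) hfc (by
          have : Continuous (fun t => - (deriv (tprof d w) (Real.cos t) * Real.sin t ^ 2) +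
            d * (tprof d w (Real.cos t) * Real.cos t)) := by fun_prop
          exact this.measurable) ⟨C2 + d * C1, fun t => by
            have m : Real.cos t ∈ Set.Icc (-1 : ℝ) 1 := ⟨Real.neg_one_le_cos t, Real.cos_le_one t⟩
            have a1 := hC1 _ m
            have a2 := hC2 _ m
            have hd0 : (0 : ℝ) ≤ d := Nat.cast_nonneg d
            refine (abs_add_le _ _).trans (add_le_add ?_ ?_)
            · rw [abs_neg, abs_mul]
              refine (mul_le_of_le_one_right (abs_nonneg _) ?_).trans a2
              rw [abs_pow]
              exact pow_le_one₀ (abs_nonneg _) (Real.abs_sin_le_one t)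
            · rw [abs_mul, abs_mul, Nat.abs_cast]
              refine mul_le_mul_of_nonneg_left ?_ hd0
              exact (mul_le_of_le_one_right (abs_nonneg _) (Real.abs_cos_le_one t)).trans a1⟩).2
  rw [key] at h
  have e1 : ∀ η : Sph d, w (geodist ζ η) * sinInt d (geodist ζ η) / Real.sin (geodist ζ η) ^ d *
        ⟪g η, (ζ : Euc (d + 1))⟫ = tprof d w (Real.cos (geodist ζ η)) * ⟪g η, (ζ : Euc (d + 1))⟫ := by
    intro η
    rw [tprof, hA _ (geodist_mem ζ η)]
  simp only [e1]
  rw [h]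
  congr 1
  refine setIntegral_congr_fun measurableSet_Ioo fun t ht => ?_
  have hs : 0 < Real.sin t := Real.sin_pos_of_mem_Ioo ht
  have hu : HasDerivAt (fun t => tprof d w (Real.cos t) * Real.sin t ^ d)
      (deriv (tprof d w) (Real.cos t) * (- Real.sin t) * Real.sin t ^ d +
        tprof d w (Real.cos t) * (d * Real.sin t ^ (d - 1) * Real.cos t)) t := by
    have d1 : HasDerivAt (tprof d w) (deriv (tprof d w) (Real.cos t)) (Real.cos t) :=
      ((hψ.differentiable (by simp)) _).hasDerivAt
    exact (d1.comp t (Real.hasDerivAt_cos t)).mul ((Real.hasDerivAt_sin t).pow d)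
  have hu2 : HasDerivAt (fun t => w t * sinInt d t)
      (deriv w t * sinInt d t + w t * Real.sin t ^ (d - 1)) t :=
    ((hw.differentiable (by simp)) t).hasDerivAt.mul (sinInt_hasDerivAt d t)
  have hev : (fun t => tprof d w (Real.cos t) * Real.sin t ^ d) =ᶠ[𝓝 t] (fun t => w t * sinInt d t) := by
    filter_upwards [isOpen_Ioo.mem_nhds ht] with x hx
    have hsx : 0 < Real.sin x := Real.sin_pos_of_mem_Ioo hx
    rw [tprof, hA x ⟨hx.1.le, hx.2.le⟩]
    field_simp
  have := hu.unique (hu2.congr_of_eventuallyEq hev)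
  beta_reduce
  rw [← this]
  have e : Real.sin t ^ d = Real.sin t ^ (d - 1) * Real.sin t := by
    rw [← pow_succ, Nat.sub_add_cancel hd]
  rw [e]
  ring

end

section


lemma chi_deriv_cont : Continuous (deriv Real.smoothTransition) :=
  (Real.smoothTransition.contDiff (n := 1)).continuous_deriv le_rfl

lemma chi_hasDeriv (x : ℝ) : HasDerivAt Real.smoothTransition (deriv Real.smoothTransition x) x :=
  ((Real.smoothTransition.contDiff (n := 1)).differentiable (by simp) x).hasDerivAt

lemma chi_deriv_zero {x : ℝ} (hx : x < 0 ∨ 1 < x) : deriv Real.smoothTransition x = 0 := by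
  rcases hx with h | h
  · have : Real.smoothTransition =ᶠ[𝓝 x] fun _ => 0 := by
      filter_upwards [isOpen_Iio.mem_nhds h] with y hy
      exact Real.smoothTransition.zero_of_nonpos (le_of_lt hy)
    rw [this.deriv_eq]; simp
  · have : Real.smoothTransition =ᶠ[𝓝 x] fun _ => 1 := by
      filter_upwards [isOpen_Ioi.mem_nhds h] with y hy
      exact Real.smoothTransition.one_of_one_le (le_of_lt hy)
    rw [this.deriv_eq]; simp

lemma chi_int (Q : ℝ → ℝ) (hQ : Continuous Q) {A B : ℝ} (hA : A ≤ 0) (hB : 1 ≤ B) :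
    ∫ x in A..B, Q x * deriv Real.smoothTransition x =
      ∫ x in (0:ℝ)..1, Q x * deriv Real.smoothTransition x := by
  have hc : Continuous (fun x => Q x * deriv Real.smoothTransition x) := hQ.mul chi_deriv_cont
  rw [← intervalIntegral.integral_add_adjacent_intervals (b := 0) (hc.intervalIntegrable _ _)
    (hc.intervalIntegrable _ _), ← intervalIntegral.integral_add_adjacent_intervals (a := 0) (b := 1) (c := B)
      (hc.intervalIntegrable _ _) (hc.intervalIntegrable _ _)]
  have z1 : ∫ x in A..0, Q x * deriv Real.smoothTransition x = 0 := by
    rw [intervalIntegral.integral_of_le hA, integral_Ioc_eq_integral_Ioo]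
    rw [setIntegral_congr_fun (g := fun _ => (0:ℝ)) measurableSet_Ioo]
    · simp
    · intro x hx
      simp [chi_deriv_zero (Or.inl hx.2)]
  have z2 : ∫ x in (1:ℝ)..B, Q x * deriv Real.smoothTransition x = 0 := by
    rw [intervalIntegral.integral_of_le hB]
    rw [setIntegral_congr_fun (g := fun _ => (0:ℝ)) measurableSet_Ioc]
    · simp
    · intro x hx
      simp [chi_deriv_zero (Or.inr hx.1)]
  rw [z1, z2]; ring

lemma moll_limit (Q : ℝ → ℝ) (hQ : Continuous Q) (p q : ℝ) (x0 x1 : ℝ)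
    (h0 : ∀ᶠ n : ℕ in atTop, (n : ℝ) * (x0 - p) + q ≤ 0)
    (h1 : ∀ᶠ n : ℕ in atTop, 1 ≤ (n : ℝ) * (x1 - p) + q) :
    Tendsto (fun n : ℕ => ∫ t in x0..x1, Q t * (n * deriv Real.smoothTransition (n * (t - p) + q)))
      atTop (𝓝 (Q p)) := by
  have hlim : Tendsto (fun s : ℝ => ∫ x in (0:ℝ)..1, Q (p + (x - q) * s) * deriv Real.smoothTransition x)
      (𝓝 0) (𝓝 (Q p)) := by
    have hc : Continuous (fun s : ℝ => ∫ x in (0:ℝ)..1, Q (p + (x - q) * s) * deriv Real.smoothTransition x) := by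
      apply intervalIntegral.continuous_parametric_intervalIntegral_of_continuous'
      have := chi_deriv_cont
      fun_prop
    have := hc.tendsto 0
    simp only [mul_zero, add_zero, intervalIntegral.integral_const_mul] at this
    rwa [intervalIntegral.integral_eq_sub_of_hasDerivAt (fun x _ => chi_hasDeriv x)
      (chi_deriv_cont.intervalIntegrable _ _), Real.smoothTransition.one, Real.smoothTransition.zero,
      sub_zero, mul_one] at this
  have := hlim.comp (tendsto_inv_atTop_nhds_zero_nat (𝕜 := ℝ))
  refine this.congr' ?_
  filter_upwards [h0, h1, eventually_gt_atTop 0] with n hn0 hn1 hn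
  have hn' : (0:ℝ) < n := by exact_mod_cast hn
  simp only [Function.comp]
  have e := intervalIntegral.mul_integral_comp_mul_add (a := x0) (b := x1)
    (f := fun x => Q (p + (x - q) * (n:ℝ)⁻¹) * deriv Real.smoothTransition x) (n:ℝ) (q - n * p)
  rw [← chi_int (fun x => Q (p + (x - q) * (n:ℝ)⁻¹)) (by fun_prop) hn0 hn1]
  have e1 : (n:ℝ) * (x0 - p) + q = n * x0 + (q - n * p) := by ring
  have e2 : (n:ℝ) * (x1 - p) + q = n * x1 + (q - n * p) := by ring
  rw [e1, e2, ← e, ← intervalIntegral.integral_const_mul]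
  refine intervalIntegral.integral_congr fun t _ => ?_
  have e3 : p + (n * t + (q - n * p) - q) * (n:ℝ)⁻¹ = t := by field_simp; ring
  have e4 : n * t + (q - n * p) = n * (t - p) + q := by ring
  rw [e3, e4]
  ring

/-- cut-off functions -/
def cutf (r : ℝ) (n : ℕ) (t : ℝ) : ℝ :=
  Real.smoothTransition (n * (t - 0) + (-1)) - Real.smoothTransition (n * (t - r) + 1)

lemma cutf_smooth (r : ℝ) (n : ℕ) : ContDiff ℝ (⊤ : ℕ∞) (cutf r n) := by
  unfold cutf
  refine ContDiff.sub ?_ ?_ <;>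
  · refine Real.smoothTransition.contDiff.comp ?_
    fun_prop

lemma cutf_deriv (r : ℝ) (n : ℕ) (t : ℝ) : deriv (cutf r n) t =
    n * deriv Real.smoothTransition (n * (t - 0) + (-1)) -
      n * deriv Real.smoothTransition (n * (t - r) + 1) := by
  apply HasDerivAt.deriv
  have h : ∀ p q : ℝ, HasDerivAt (fun t => Real.smoothTransition (n * (t - p) + q))
      (n * deriv Real.smoothTransition (n * (t - p) + q)) t := by
    intro p q
    have h1 : HasDerivAt (fun t : ℝ => (n:ℝ) * (t - p) + q) n t := by
      simpa using (((hasDerivAt_id t).sub_const p).const_mul (n:ℝ)).add_const q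
    have := (chi_hasDeriv (n * (t - p) + q)).comp t h1
    rwa [mul_comm] at this
  exact (h 0 (-1)).sub (h r 1)

lemma cutf_abs (r : ℝ) (n : ℕ) (t : ℝ) : |cutf r n t| ≤ 1 := by
  unfold cutf
  have a1 := Real.smoothTransition.nonneg (n * (t - 0) + (-1))
  have a2 := Real.smoothTransition.le_one (n * (t - 0) + (-1))
  have a3 := Real.smoothTransition.nonneg (n * (t - r) + 1)
  have a4 := Real.smoothTransition.le_one (n * (t - r) + 1)
  rw [abs_le]; constructor <;> linarith

lemma cutf_zero_left {r : ℝ} {n : ℕ} (hn : 2 ≤ n * r) (hr : 0 < r) {t : ℝ} (ht : t ≤ (n:ℝ)⁻¹) :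
    cutf r n t = 0 := by
  have hn' : (0:ℝ) < n := by
    by_contra h
    nlinarith
  have : n * t ≤ 1 := by
    calc n * t ≤ n * (n:ℝ)⁻¹ := by gcongr
      _ = 1 := by field_simp
  unfold cutf
  rw [Real.smoothTransition.zero_of_nonpos (by linarith), Real.smoothTransition.zero_of_nonpos (by nlinarith), sub_zero]

lemma cutf_zero_right {r : ℝ} {n : ℕ} (hn : 2 ≤ n * r) {t : ℝ} (ht : r ≤ t) :
    cutf r n t = 0 := by
  have hn' : (0:ℝ) ≤ n := Nat.cast_nonneg n
  have : n * r ≤ n * t := by gcongr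
  unfold cutf
  rw [Real.smoothTransition.one_of_one_le (by linarith), Real.smoothTransition.one_of_one_le (by nlinarith), sub_self]

lemma nat_ev (p C : ℝ) (hp : 0 < p) : ∀ᶠ n : ℕ in atTop, C ≤ n * p := by
  have : Tendsto (fun n : ℕ => (n:ℝ) * p) atTop atTop :=
    tendsto_natCast_atTop_atTop.atTop_mul_const hp
  exact this.eventually_ge_atTop C

lemma cutf_lim_one {r t : ℝ} (h0 : 0 < t) (h1 : t < r) : ∀ᶠ n : ℕ in atTop, cutf r n t = 1 := by
  filter_upwards [nat_ev t 2 h0, nat_ev (r - t) 1 (by linarith)] with n hn1 hn2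
  unfold cutf
  rw [Real.smoothTransition.one_of_one_le (by linarith), Real.smoothTransition.zero_of_nonpos (by nlinarith), sub_zero]

lemma cutf_tendsto {r : ℝ} (hr : 0 < r) (t : ℝ) : Tendsto (fun n => cutf r n t) atTop
    (𝓝 ((Set.Ioo 0 r).indicator 1 t)) := by
  by_cases ht : t ∈ Set.Ioo 0 r
  · rw [Set.indicator_of_mem ht]
    exact tendsto_const_nhds.congr' ((cutf_lim_one ht.1 ht.2).mono fun n hn => hn.symm)
  · rw [Set.indicator_of_notMem ht]
    refine tendsto_const_nhds.congr' ((nat_ev r 2 hr).mono fun n hn => ?_)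
    rcases le_or_gt t 0 with h | h
    · exact (cutf_zero_left hn hr (h.trans (by positivity))).symm
    · exact (cutf_zero_right hn (not_lt.1 fun h' => ht ⟨h, h'⟩)).symm

lemma rad_limit (d : ℕ) {r : ℝ} (h0 : 0 < r) (h1 : r < Real.pi) (F : ℝ → ℝ) (hF : Continuous F) :
    Tendsto (fun n => ∫ t in Set.Ioo 0 Real.pi, F t *
        (deriv (cutf r n) t * sinInt d t + cutf r n t * Real.sin t ^ (d - 1))) atTop
      (𝓝 ((∫ t in (0:ℝ)..r, F t * Real.sin t ^ (d - 1)) - F r * sinInt d r)) := by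
  have hS : Continuous (sinInt d) := (sinInt_contDiff d).continuous
  have hQ : Continuous (fun t => F t * sinInt d t) := hF.mul hS
  have hx := chi_deriv_cont
  have hcc : ∀ n, Continuous (cutf r n) := fun n => (cutf_smooth r n).continuous
  have L1 := moll_limit _ hQ 0 (-1) 0 Real.pi (by simp)
    ((nat_ev Real.pi 2 Real.pi_pos).mono fun n hn => by linarith)
  have L2 := moll_limit _ hQ r 1 0 Real.pi
    ((nat_ev r 1 h0).mono fun n hn => by linarith)
    (Eventually.of_forall fun n => by
      have : (0:ℝ) ≤ n * (Real.pi - r) := mul_nonneg (Nat.cast_nonneg n) (by linarith)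
      linarith)
  have L3 : Tendsto (fun n => ∫ t in (0:ℝ)..Real.pi, cutf r n t * (F t * Real.sin t ^ (d - 1))) atTop
      (𝓝 (∫ t in (0:ℝ)..Real.pi, (Set.Ioo 0 r).indicator 1 t * (F t * Real.sin t ^ (d - 1)))) := by
    refine intervalIntegral.tendsto_integral_filter_of_dominated_convergence
      (fun t => |F t * Real.sin t ^ (d - 1)|) ?_ ?_ ?_ ?_
    · refine Eventually.of_forall fun n => ?_
      have := hcc n
      exact Continuous.aestronglyMeasurable (by fun_prop)
    · refine Eventually.of_forall fun n => ae_of_all _ fun t _ => ?_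
      rw [norm_mul]
      exact mul_le_of_le_one_left (norm_nonneg _) (cutf_abs r n t)
    · exact Continuous.intervalIntegrable (by fun_prop) _ _
    · exact ae_of_all _ fun t _ => (cutf_tendsto h0 t).mul_const _
  have e3 : (∫ t in (0:ℝ)..Real.pi, (Set.Ioo 0 r).indicator 1 t * (F t * Real.sin t ^ (d - 1))) =
      ∫ t in (0:ℝ)..r, F t * Real.sin t ^ (d - 1) := by
    rw [intervalIntegral.integral_of_le h0.le, intervalIntegral.integral_of_le Real.pi_pos.le,
      integral_Ioc_eq_integral_Ioo (y := r)]
    rw [← integral_indicator measurableSet_Ioc, ← integral_indicator measurableSet_Ioo]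
    congr 1
    ext t
    by_cases ht : t ∈ Set.Ioo 0 r
    · have : t ∈ Set.Ioc 0 Real.pi := ⟨ht.1, ht.2.le.trans h1.le⟩
      simp only [Set.indicator_of_mem ht, Set.indicator_of_mem this, Pi.one_apply, one_mul]
    · rw [Set.indicator_of_notMem ht]
      by_cases h : t ∈ Set.Ioc 0 Real.pi
      · rw [Set.indicator_of_mem h, Set.indicator_of_notMem ht, zero_mul]
      · rw [Set.indicator_of_notMem h]
  have key := (L1.sub L2).add L3
  have s0 : sinInt d 0 = 0 := by simp [sinInt]
  rw [e3, s0, mul_zero, zero_sub, neg_add_eq_sub] at key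
  refine key.congr fun n => ?_
  have := hcc n
  rw [← integral_Ioc_eq_integral_Ioo, ← intervalIntegral.integral_of_le Real.pi_pos.le,
    ← intervalIntegral.integral_sub, ← intervalIntegral.integral_add]
  · refine intervalIntegral.integral_congr fun t _ => ?_
    simp only [cutf_deriv]
    ring
  all_goals exact Continuous.intervalIntegrable (by fun_prop) _ _

lemma sin_ratio_bound (d : ℕ) {r : ℝ} (h1 : r < Real.pi) {t : ℝ} (ht0 : 0 < t) (htr : t ≤ r) :
    |sinInt d t / sinPow d t| ≤ Real.pi / Real.sin r ^ (d - 1) := by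
  have hsr : 0 < Real.sin r := Real.sin_pos_of_mem_Ioo ⟨ht0.trans_le htr, h1⟩
  have hst : 0 < Real.sin t := Real.sin_pos_of_mem_Ioo ⟨ht0, htr.trans_lt h1⟩
  have hb : ∀ τ ∈ Set.Icc 0 t, Real.sin τ ≤ Real.sin t / Real.sin r := by
    intro τ hτ
    rw [le_div_iff₀ hsr]
    rcases le_or_gt t (Real.pi / 2) with h | h
    · have : Real.sin τ ≤ Real.sin t := Real.sin_le_sin_of_le_of_le_pi_div_two
        (by linarith [hτ.1, Real.pi_pos]) h hτ.2
      nlinarith [Real.sin_le_one r]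
    · have : Real.sin r ≤ Real.sin t := by
        rw [← Real.sin_pi_sub r, ← Real.sin_pi_sub t]
        exact Real.sin_le_sin_of_le_of_le_pi_div_two (by linarith) (by linarith) (by linarith)
      nlinarith [Real.sin_le_one τ]
  have hS : sinInt d t ≤ t * (Real.sin t / Real.sin r) ^ (d - 1) := by
    have : sinInt d t ≤ ∫ τ in (0:ℝ)..t, (Real.sin t / Real.sin r) ^ (d - 1) := by
      refine intervalIntegral.integral_mono_on ht0.le
        (Continuous.intervalIntegrable (by fun_prop) _ _) (by simp) fun τ hτ => ?_
      exact pow_le_pow_left₀ (Real.sin_nonneg_of_mem_Icc ⟨hτ.1, by linarith [hτ.2]⟩) (hb τ hτ) _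
    simpa using this
  have hS0 : 0 ≤ sinInt d t := by
    refine intervalIntegral.integral_nonneg ht0.le fun τ hτ => ?_
    exact pow_nonneg (Real.sin_nonneg_of_mem_Icc ⟨hτ.1, by linarith [hτ.2]⟩) _
  unfold sinPow
  rw [abs_of_nonneg (by positivity), div_le_div_iff₀ (by positivity) (by positivity)]
  rw [div_pow] at hS
  calc sinInt d t * Real.sin r ^ (d - 1) ≤ t * (Real.sin t ^ (d-1) / Real.sin r ^ (d-1)) * Real.sin r ^ (d - 1) := by gcongr
    _ = t * Real.sin t ^ (d - 1) := by field_simp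
    _ ≤ _ := by gcongr; linarith

end

section


lemma proj_norm {d : ℕ} (ζ η : Sph d) :
    ‖(ζ : Euc (d + 1)) - ⟪(η : Euc (d + 1)), (ζ : Euc (d + 1))⟫ • (η : Euc (d + 1))‖ =
      Real.sin (geodist ζ η) := by
  have hs : 0 ≤ Real.sin (geodist ζ η) := Real.sin_nonneg_of_mem_Icc (geodist_mem ζ η)
  have nz : ‖(ζ : Euc (d + 1))‖ = 1 := norm_eq_of_mem_sphere ζ
  have nη : ‖(η : Euc (d + 1))‖ = 1 := norm_eq_of_mem_sphere η
  refine (pow_left_inj₀ (norm_nonneg _) hs two_ne_zero).1 ?_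
  rw [Real.sin_sq, geodist_cos, norm_sub_sq_real, inner_smul_right, norm_smul, nz, nη,
    Real.norm_eq_abs, mul_one, sq_abs, real_inner_comm (η : Euc (d + 1))]
  ring

lemma inner_gdir {d : ℕ} (ζ η : Sph d) (v : Euc (d + 1)) (hv : ⟪v, (η : Euc (d + 1))⟫ = 0) :
    ⟪v, (ζ : Euc (d + 1))⟫ = Real.sin (geodist ζ η) * ⟪v, gdir η ζ⟫ := by
  have h1 : ⟪v, (ζ : Euc (d + 1))⟫ =
      ⟪v, (ζ : Euc (d + 1)) - ⟪(η : Euc (d + 1)), (ζ : Euc (d + 1))⟫ • (η : Euc (d + 1))⟫ := by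
    rw [inner_sub_right, inner_smul_right, hv]; ring
  rw [h1, ← proj_norm, gdir, inner_smul_right, ← mul_assoc]
  by_cases h : ‖(ζ : Euc (d + 1)) - ⟪(η : Euc (d + 1)), (ζ : Euc (d + 1))⟫ • (η : Euc (d + 1))‖ = 0
  · rw [norm_eq_zero.1 h]; simp
  · rw [mul_inv_cancel₀ h, one_mul]

lemma gdir_norm_le {d : ℕ} (ζ η : Sph d) : ‖gdir η ζ‖ ≤ 1 := by
  unfold gdir
  rw [norm_smul, norm_inv, norm_norm]
  exact inv_mul_le_one

lemma gdir_zero {d : ℕ} (ζ η : Sph d) (h : Real.sin (geodist ζ η) = 0) : gdir η ζ = 0 := by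
  rw [← proj_norm] at h
  unfold gdir
  rw [norm_eq_zero.1 h, smul_zero]

lemma gdir_meas {d : ℕ} (ζ : Sph d) : Measurable (fun η : Sph d => gdir η ζ) := by
  unfold gdir
  have h : Continuous (fun η : Sph d =>
      (ζ : Euc (d + 1)) - ⟪(η : Euc (d + 1)), (ζ : Euc (d + 1))⟫ • (η : Euc (d + 1))) := by fun_prop
  exact h.measurable.norm.inv.smul h.measurable

lemma grad_radial (d : ℕ) (hd : 1 ≤ d) (ζ : Sph d) (L : Euc d →ₗᵢ[ℝ] Euc (d + 1))
    (hL : ∀ z, ⟪(ζ : Euc (d + 1)), L z⟫ = 0) (c : ℝ)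
    (hc : ∀ (f : Sph d → ℝ) (k : ℝ → ℝ), Continuous f → Measurable k → (∃ C, ∀ t, |k t| ≤ C) →
      Integrable (fun η => k (geodist ζ η) * f η) (sphMeasure d) ∧
      ∫ η, k (geodist ζ η) * f η ∂(sphMeasure d) =
        c * ∫ t in Set.Ioo 0 Real.pi, k t * (sMean ζ L hL f t * Real.sin t ^ (d - 1)))
    (f : Sph d → ℝ) (g : Sph d → Euc (d + 1))
    (hf : MemW11 f g) (hfc : Continuous f) {r : ℝ} (h0 : 0 < r) (h1 : r < Real.pi) :
    ∫ η in gball ζ r, ⟪g η, gdir η ζ⟫ * (sinInt d (geodist ζ η) / sinPow d (geodist ζ η))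
        ∂(sphMeasure d) =
      c * ((∫ t in (0:ℝ)..r, sMean ζ L hL f t * Real.sin t ^ (d - 1)) -
        sMean ζ L hL f r * sinInt d r) := by
  have hFc := sMean_cont ζ L hL f hfc
  have R := (rad_limit d h0 h1 _ hFc).const_mul c
  have hball : MeasurableSet (gball ζ r) := (geodist_cont ζ).measurable measurableSet_Iio
  have hgm : AEStronglyMeasurable g (sphMeasure d) := hf.2.1.aestronglyMeasurable
  have hKm : Measurable (fun t => sinInt d t / sinPow d t) := by
    have h1 : Continuous (sinInt d) := (sinInt_contDiff d).continuous
    have h2 : Continuous (sinPow d) := by unfold sinPow; fun_prop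
    exact h1.measurable.div h2.measurable
  have hgd := geodist_cont ζ
  have hsm : AEStronglyMeasurable (fun η => ⟪g η, gdir η ζ⟫ *
      (sinInt d (geodist ζ η) / sinPow d (geodist ζ η))) (sphMeasure d) :=
    (hgm.inner (gdir_meas ζ).aestronglyMeasurable).mul
      (hKm.comp hgd.measurable).aestronglyMeasurable
  have T : Tendsto (fun n => ∫ η, cutf r n (geodist ζ η) * (⟪g η, gdir η ζ⟫ *
      (sinInt d (geodist ζ η) / sinPow d (geodist ζ η))) ∂(sphMeasure d)) atTop
      (𝓝 (∫ η, (gball ζ r).indicator (fun η => ⟪g η, gdir η ζ⟫ *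
      (sinInt d (geodist ζ η) / sinPow d (geodist ζ η))) η ∂(sphMeasure d))) := by
    refine tendsto_integral_filter_of_dominated_convergence
      (fun η => ‖g η‖ * (Real.pi / Real.sin r ^ (d - 1))) ?_ ?_ ?_ ?_
    · refine Eventually.of_forall fun n => ?_
      exact (((cutf_smooth r n).continuous.comp hgd).aestronglyMeasurable).mul hsm
    · refine (nat_ev r 2 h0).mono fun n hn => ae_of_all _ fun η => ?_
      have hsr : 0 < Real.sin r := Real.sin_pos_of_mem_Ioo ⟨h0, h1⟩
      rcases le_or_gt r (geodist ζ η) with h | h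
      · rw [cutf_zero_right hn h, zero_mul, norm_zero]
        have := Real.pi_pos
        positivity
      · rcases (geodist_mem ζ η).1.eq_or_lt with h' | h'
        · rw [cutf_zero_left hn h0 (by rw [← h']; positivity), zero_mul, norm_zero]
          have := Real.pi_pos
          positivity
        · rw [norm_mul, norm_mul]
          refine (mul_le_of_le_one_left (by positivity) (cutf_abs r n _)).trans ?_
          refine mul_le_mul ?_ (sin_ratio_bound d h1 h' h.le) (norm_nonneg _) (norm_nonneg _)
          refine (norm_inner_le_norm _ _).trans ?_
          exact mul_le_of_le_one_right (norm_nonneg _) (gdir_norm_le _ _)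
    · exact hf.2.1.norm.mul_const _
    · refine ae_of_all _ fun η => ?_
      have := (cutf_tendsto h0 (geodist ζ η)).mul_const (⟪g η, gdir η ζ⟫ *
        (sinInt d (geodist ζ η) / sinPow d (geodist ζ η)))
      convert this using 2
      by_cases hη : η ∈ gball ζ r
      · rw [Set.indicator_of_mem hη]
        rcases (geodist_mem ζ η).1.eq_or_lt with h' | h'
        · rw [gdir_zero ζ η (by rw [← h', Real.sin_zero])]
          simp
        · rw [Set.indicator_of_mem (show geodist ζ η ∈ Set.Ioo 0 r from ⟨h', hη⟩)]; simp
      · rw [Set.indicator_of_notMem hη, Set.indicator_of_notMem (fun h => hη h.2), zero_mul]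
  rw [integral_indicator hball] at T
  refine tendsto_nhds_unique T (R.congr' ?_)
  filter_upwards [nat_ev r 2 h0] with n hn
  have hn' : (0:ℝ) < n := by
    by_contra h
    nlinarith
  rw [← weak_polar d hd ζ L hL c hc f g hf hfc (cutf r n) (cutf_smooth r n) (inv_pos.2 hn') h1
    (fun t ht => cutf_zero_left hn h0 ht) (fun t ht => cutf_zero_right hn ht)]
  refine integral_congr_ae ?_
  filter_upwards [hf.2.2.1] with η hη
  rw [inner_gdir ζ η _ hη, sinPow]
  by_cases hs : Real.sin (geodist ζ η) = 0
  · rw [gdir_zero ζ η hs]; simp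
  · have e : Real.sin (geodist ζ η) ^ d = Real.sin (geodist ζ η) ^ (d - 1) * Real.sin (geodist ζ η) := by
      rw [← pow_succ, Nat.sub_add_cancel hd]
    rw [e]
    field_simp

end

section


lemma sinInt_pos (d : ℕ) {s : ℝ} (h0 : 0 < s) (h1 : s ≤ Real.pi) : 0 < sinInt d s := by
  refine intervalIntegral.intervalIntegral_pos_of_pos_on
    (Continuous.intervalIntegrable (by fun_prop) _ _) (fun x hx => ?_) h0
  exact pow_pos (Real.sin_pos_of_mem_Ioo ⟨hx.1, hx.2.trans_le h1⟩) _

lemma ball_int (d : ℕ) (ζ : Sph d) (L : Euc d →ₗᵢ[ℝ] Euc (d + 1))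
    (hL : ∀ z, ⟪(ζ : Euc (d + 1)), L z⟫ = 0) (c : ℝ)
    (hc : ∀ (f : Sph d → ℝ) (k : ℝ → ℝ), Continuous f → Measurable k → (∃ C, ∀ t, |k t| ≤ C) →
      Integrable (fun η => k (geodist ζ η) * f η) (sphMeasure d) ∧
      ∫ η, k (geodist ζ η) * f η ∂(sphMeasure d) =
        c * ∫ t in Set.Ioo 0 Real.pi, k t * (sMean ζ L hL f t * Real.sin t ^ (d - 1)))
    (f : Sph d → ℝ) (hfc : Continuous f) {s : ℝ} (h0 : 0 < s) (h1 : s ≤ Real.pi) :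
    ∫ η in gball ζ s, f η ∂(sphMeasure d) =
      c * ∫ t in (0:ℝ)..s, sMean ζ L hL f t * Real.sin t ^ (d - 1) := by
  have hball : MeasurableSet (gball ζ s) := (geodist_cont ζ).measurable measurableSet_Iio
  have h := (hc f ((Set.Iio s).indicator 1) hfc (measurable_one.indicator measurableSet_Iio)
    ⟨1, fun t => by
      by_cases ht : t ∈ Set.Iio s
      · rw [Set.indicator_of_mem ht]; simp
      · rw [Set.indicator_of_notMem ht]; simp⟩).2
  have e1 : ∀ η, (Set.Iio s).indicator (1 : ℝ → ℝ) (geodist ζ η) * f η = (gball ζ s).indicator f η := by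
    intro η
    by_cases hη : η ∈ gball ζ s
    · rw [Set.indicator_of_mem hη, Set.indicator_of_mem (show geodist ζ η ∈ Set.Iio s from hη)]; simp
    · rw [Set.indicator_of_notMem hη, Set.indicator_of_notMem (show ¬ geodist ζ η ∈ Set.Iio s from hη)]; simp
  simp only [e1] at h
  rw [integral_indicator hball] at h
  rw [h, intervalIntegral.integral_of_le h0.le, integral_Ioc_eq_integral_Ioo,
    ← integral_indicator measurableSet_Ioo, ← integral_indicator measurableSet_Ioo]
  congr 2
  ext t
  by_cases ht : t ∈ Set.Ioo 0 s
  · rw [Set.indicator_of_mem ht, Set.indicator_of_mem (show t ∈ Set.Ioo 0 Real.pi from ⟨ht.1, ht.2.trans_le h1⟩),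
      Set.indicator_of_mem (show t ∈ Set.Iio s from ht.2)]
    simp
  · rw [Set.indicator_of_notMem ht]
    by_cases h : t ∈ Set.Ioo 0 Real.pi
    · rw [Set.indicator_of_mem h, Set.indicator_of_notMem (show ¬ t ∈ Set.Iio s from fun h' => ht ⟨h.1, h'⟩),
        zero_mul]
    · rw [Set.indicator_of_notMem h]

lemma ball_meas (d : ℕ) (ζ : Sph d) (L : Euc d →ₗᵢ[ℝ] Euc (d + 1))
    (hL : ∀ z, ⟪(ζ : Euc (d + 1)), L z⟫ = 0) (c : ℝ)
    (hc : ∀ (f : Sph d → ℝ) (k : ℝ → ℝ), Continuous f → Measurable k → (∃ C, ∀ t, |k t| ≤ C) →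
      Integrable (fun η => k (geodist ζ η) * f η) (sphMeasure d) ∧
      ∫ η, k (geodist ζ η) * f η ∂(sphMeasure d) =
        c * ∫ t in Set.Ioo 0 Real.pi, k t * (sMean ζ L hL f t * Real.sin t ^ (d - 1)))
    {s : ℝ} (h0 : 0 < s) (h1 : s ≤ Real.pi) :
    (sphMeasure d).real (gball ζ s) =
      c * ((volume : Measure (Euc d)).toSphere.real Set.univ * sinInt d s) := by
  have h := ball_int d ζ L hL c hc (fun _ => 1) continuous_const h0 h1
  rw [setIntegral_const, smul_eq_mul, mul_one] at h
  rw [h]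
  congr 1
  simp only [sMean, integral_const, smul_eq_mul, mul_one]
  rw [intervalIntegral.integral_const_mul, sinInt]

/-- geodesic through `ξ` with direction `v` -/
def gcurve {d : ℕ} (ξ : Sph d) (v : Euc (d + 1)) (hv : ‖v‖ = 1) (ho : ⟪(ξ : Euc (d + 1)), v⟫ = 0)
    (t : ℝ) : Sph d :=
  ⟨Real.cos t • (ξ : Euc (d + 1)) + Real.sin t • v, by
    rw [mem_sphere_zero_iff_norm]
    have h1 : ‖(ξ : Euc (d + 1))‖ = 1 := norm_eq_of_mem_sphere ξ
    have : ‖Real.cos t • (ξ : Euc (d + 1)) + Real.sin t • v‖ ^ 2 = 1 := by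
      rw [norm_add_sq_real, inner_smul_left, inner_smul_right, ho, norm_smul, norm_smul, h1, hv]
      simp
    have h0 := norm_nonneg (Real.cos t • (ξ : Euc (d + 1)) + Real.sin t • v)
    nlinarith⟩

lemma gcurve_zero {d : ℕ} (ξ : Sph d) (v : Euc (d + 1)) (hv : ‖v‖ = 1)
    (ho : ⟪(ξ : Euc (d + 1)), v⟫ = 0) : gcurve ξ v hv ho 0 = ξ := by
  apply Subtype.ext
  simp [gcurve]

lemma gcurve_deriv {d : ℕ} (u : Sph d → ℝ) (G : Euc (d + 1)) (ξ : Sph d)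
    (hdiff : HasSphereGradAt u G ξ) (v : Euc (d + 1)) (hv : ‖v‖ = 1)
    (ho : ⟪(ξ : Euc (d + 1)), v⟫ = 0) :
    HasDerivAt (fun t => u (gcurve ξ v hv ho t)) ⟪G, v⟫ 0 := by
  have hd : HasDerivAt (fun t => ((gcurve ξ v hv ho t : Sph d) : Euc (d + 1))) v 0 := by
    have h := ((Real.hasDerivAt_cos 0).smul_const (ξ : Euc (d + 1))).add
      ((Real.hasDerivAt_sin 0).smul_const v)
    have e : -Real.sin 0 • (ξ : Euc (d + 1)) + Real.cos 0 • v = v := by simp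
    rw [e] at h
    exact h
  have hcont : Tendsto (gcurve ξ v hv ho) (𝓝 0) (𝓝 ξ) := by
    rw [tendsto_subtype_rng]
    have := hd.continuousAt.tendsto
    rwa [gcurve_zero] at this
  have h1 := hdiff.2.comp_tendsto hcont
  have hO : (fun t => dist (gcurve ξ v hv ho t) ξ) =O[𝓝 0] (fun t : ℝ => t - 0) := by
    have := hd.isBigO_sub
    refine IsBigO.congr_left this.norm_left ?_
    intro t
    rw [gcurve_zero, ← dist_eq_norm]
    rfl
  have h2 := h1.trans_isBigO hO
  have h3 : HasDerivAt (fun t => u (gcurve ξ v hv ho t) - u ξ -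
      ⟪G, (gcurve ξ v hv ho t : Euc (d + 1)) - (ξ : Euc (d + 1))⟫) 0 0 := by
    rw [hasDerivAt_iff_isLittleO]
    refine h2.congr_left fun t => ?_
    simp [gcurve_zero]
  have h4 : HasDerivAt (fun t => ⟪G, (gcurve ξ v hv ho t : Euc (d + 1)) - (ξ : Euc (d + 1))⟫) ⟪G, v⟫ 0 := by
    have := (hasDerivAt_const (0:ℝ) G).inner ℝ (hd.sub_const (ξ : Euc (d + 1)))
    simpa using this
  have h5 := (h3.add h4).add_const (u ξ)
  rw [zero_add] at h5
  refine h5.congr_of_eventuallyEq (Eventually.of_forall fun t => ?_)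
  simp

lemma avg_bound {d : ℕ} (f : Sph d → ℝ) (C : ℝ) (hC0 : 0 ≤ C) (hC : ∀ x, |f x| ≤ C) (s : Set (Sph d)) :
    ⨍ η in s, |f η| ∂(sphMeasure d) ≤ C := by
  rw [setAverage_eq, smul_eq_mul]
  have h := norm_setIntegral_le_of_norm_le_const (μ := sphMeasure d) (s := s) (f := fun η => |f η|) (C := C)
    (measure_lt_top _ _) (fun x _ => by simpa using hC x)
  have h2 := (le_abs_self _).trans h
  have h3 : (0:ℝ) ≤ (sphMeasure d).real s := measureReal_nonneg
  rcases h3.eq_or_lt with h4 | h4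
  · rw [← h4]; simpa using hC0
  · rw [inv_mul_le_iff₀ h4]; linarith

lemma sphMax_ge {d : ℕ} (β : ℝ) (hβ : 0 < β) (f : Sph d → ℝ) (hf : Continuous f) (ξ ζ : Sph d) (r : ℝ)
    (h0 : 0 < r) (h1 : r ≤ Real.pi) (h : geodist ζ ξ ≤ r) :
    r ^ β * ⨍ η in gball ζ r, |f η| ∂(sphMeasure d) ≤ sphMax β f ξ := by
  obtain ⟨C, hC0, hC⟩ := sph_bdd f hf
  refine le_csSup ⟨Real.pi ^ β * C, ?_⟩ ⟨ζ, r, h0, h1, h, rfl⟩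
  rintro a ⟨ζ', s, hs0, hs1, -, rfl⟩
  have := avg_bound f C hC0 hC (gball ζ' s)
  have h2 : s ^ β ≤ Real.pi ^ β := Real.rpow_le_rpow hs0.le hs1 hβ.le
  have h3 : 0 ≤ s ^ β := Real.rpow_nonneg hs0.le _
  calc _ ≤ s ^ β * C := by gcongr
    _ ≤ _ := by gcongr

lemma sphAct_mp {d : ℕ} (T : Euc (d + 1) ≃ₗᵢ[ℝ] Euc (d + 1)) :
    MeasurePreserving (sphAct T) (sphMeasure d) (sphMeasure d) := by
  refine ⟨(sphAct_cont T).measurable, ?_⟩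
  ext s hs
  rw [Measure.map_apply (sphAct_cont T).measurable hs]
  exact hausSph_inv _ T s

lemma geodist_act {d : ℕ} (T : Euc (d + 1) ≃ₗᵢ[ℝ] Euc (d + 1)) (ζ η : Sph d) :
    geodist (sphAct T ζ) (sphAct T η) = geodist ζ η := by
  unfold geodist
  congr 1
  exact T.inner_map_map _ _

lemma sphMax_act {d : ℕ} (β : ℝ) (f : Sph d → ℝ) (T : Euc (d + 1) ≃ₗᵢ[ℝ] Euc (d + 1))
    (hT : ∀ η, f (sphAct T η) = f η) (hTT : ∀ x, T (T x) = x) (ξ : Sph d) :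
    sphMax β f (sphAct T ξ) = sphMax β f ξ := by
  have hinv : ∀ η : Sph d, sphAct T (sphAct T η) = η := fun η => Subtype.ext (hTT _)
  have hemb : MeasurableEmbedding (sphAct T : Sph d → Sph d) := by
    refine ((sphAct_cont T).isClosedEmbedding ?_).measurableEmbedding
    exact Function.LeftInverse.injective hinv
  have hav : ∀ (ζ : Sph d) (r : ℝ), ⨍ η in gball (sphAct T ζ) r, |f η| ∂(sphMeasure d) =
      ⨍ η in gball ζ r, |f η| ∂(sphMeasure d) := by
    intro ζ r
    have hp : sphAct T ⁻¹' (gball (sphAct T ζ) r) = gball ζ r := by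
      ext η
      simp only [gball, Set.mem_preimage, Set.mem_ofPred_eq, geodist_act]
    have h1 := (sphAct_mp T).setIntegral_preimage_emb hemb (fun η => |f η|) (gball (sphAct T ζ) r)
    rw [hp] at h1
    simp only [hT] at h1
    have hball : MeasurableSet (gball (sphAct T ζ) r) := (geodist_cont _).measurable measurableSet_Iio
    have h2 : (sphMeasure d).real (gball ζ r) = (sphMeasure d).real (gball (sphAct T ζ) r) := by
      rw [← hp, (sphAct_mp T).measureReal_preimage hball.nullMeasurableSet]
    rw [setAverage_eq, setAverage_eq, h1, h2]
  unfold sphMax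
  congr 1
  ext a
  constructor
  · rintro ⟨ζ, r, h0, h1, h2, rfl⟩
    refine ⟨sphAct T ζ, r, h0, h1, ?_, ?_⟩
    · rwa [← geodist_act T, hinv]
    · rw [hav]
  · rintro ⟨ζ, r, h0, h1, h2, rfl⟩
    refine ⟨sphAct T ζ, r, h0, h1, ?_, ?_⟩
    · rwa [geodist_act]
    · rw [hav]

end

section


lemma polarAngle_mem {d : ℕ} (ξ : Sph d) (hξ : ξ ≠ npole d ∧ ξ ≠ spole d) :
    polarAngle ξ ∈ Set.Ioo 0 Real.pi := by
  have ne : ‖(npole d : Euc (d + 1))‖ = 1 := norm_eq_of_mem_sphere _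
  have nξ : ‖(ξ : Euc (d + 1))‖ = 1 := norm_eq_of_mem_sphere _
  have hm := geodist_mem (npole d) ξ
  have hc := geodist_cos (npole d) ξ
  refine ⟨lt_of_le_of_ne hm.1 fun h => hξ.1 ?_, lt_of_le_of_ne hm.2 fun h => hξ.2 ?_⟩
  · have h : geodist (npole d) ξ = 0 := h.symm
    rw [h, Real.cos_zero] at hc
    have := (inner_eq_one_iff_of_norm_eq_one (𝕜 := ℝ) ne nξ).1 hc.symm
    exact Subtype.ext this.symm
  · have h : geodist (npole d) ξ = Real.pi := h
    rw [h, Real.cos_pi] at hc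
    have h2 : ⟪-(npole d : Euc (d + 1)), (ξ : Euc (d + 1))⟫ = 1 := by
      rw [inner_neg_left, ← hc]; norm_num
    have := (inner_eq_one_iff_of_norm_eq_one (𝕜 := ℝ) (by rw [norm_neg, ne]) nξ).1 h2
    exact Subtype.ext this.symm

lemma gdir_unit {d : ℕ} (ξ : Sph d) (hξ : ξ ≠ npole d ∧ ξ ≠ spole d) :
    ‖gdir ξ (npole d)‖ = 1 ∧ ⟪(ξ : Euc (d + 1)), gdir ξ (npole d)⟫ = 0 ∧
    (npole d : Euc (d + 1)) = Real.cos (polarAngle ξ) • (ξ : Euc (d + 1)) +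
      Real.sin (polarAngle ξ) • gdir ξ (npole d) := by
  have nξ : ‖(ξ : Euc (d + 1))‖ = 1 := norm_eq_of_mem_sphere _
  have hs : 0 < Real.sin (polarAngle ξ) := Real.sin_pos_of_mem_Ioo (polarAngle_mem ξ hξ)
  have hn := proj_norm (npole d) ξ
  change _ = Real.sin (polarAngle ξ) at hn
  have hc : Real.cos (polarAngle ξ) = ⟪(npole d : Euc (d + 1)), (ξ : Euc (d + 1))⟫ := geodist_cos (npole d) ξ
  unfold gdir
  rw [hn]
  refine ⟨?_, ?_, ?_⟩
  · rw [norm_smul, hn, norm_inv, Real.norm_of_nonneg hs.le, inv_mul_cancel₀ hs.ne']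
  · rw [inner_smul_right, inner_sub_right, inner_smul_right, real_inner_self_eq_norm_sq, nξ]
    ring
  · rw [smul_smul, mul_inv_cancel₀ hs.ne', one_smul, hc, real_inner_comm (ξ : Euc (d + 1))]
    abel

lemma circle_geom {d : ℕ} (ξ ζ : Sph d) (hξ : ξ ≠ npole d ∧ ξ ≠ spole d)
    (hζ : OnHalfGreatCircle ξ ζ) (hθ : polarAngle ζ < polarAngle ξ) :
    0 < geodist ζ ξ ∧ geodist ζ ξ < Real.pi ∧
      ⟪(ζ : Euc (d + 1)), gdir ξ (npole d)⟫ = Real.sin (geodist ζ ξ) := by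
  have ne : ‖(npole d : Euc (d + 1))‖ = 1 := norm_eq_of_mem_sphere _
  have nξ : ‖(ξ : Euc (d + 1))‖ = 1 := norm_eq_of_mem_sphere _
  have nζ : ‖(ζ : Euc (d + 1))‖ = 1 := norm_eq_of_mem_sphere _
  have hθm := polarAngle_mem ξ hξ
  have hs : 0 < Real.sin (polarAngle ξ) := Real.sin_pos_of_mem_Ioo hθm
  obtain ⟨-, hv0, hve⟩ := gdir_unit ξ hξ
  obtain ⟨a, b, hb, hab⟩ := hζ
  have hζm : polarAngle ζ ∈ Set.Icc 0 Real.pi := geodist_mem (npole d) ζ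
  have hsζ : 0 ≤ Real.sin (polarAngle ζ) := Real.sin_nonneg_of_mem_Icc hζm
  have hc : ⟪(ξ : Euc (d + 1)), (npole d : Euc (d + 1))⟫ = Real.cos (polarAngle ξ) := by
    rw [real_inner_comm]; exact (geodist_cos (npole d) ξ).symm
  have hcζ : ⟪(npole d : Euc (d + 1)), (ζ : Euc (d + 1))⟫ = Real.cos (polarAngle ζ) :=
    (geodist_cos (npole d) ζ).symm
  set e := (npole d : Euc (d + 1)) with he
  set x := (ξ : Euc (d + 1)) with hx
  set C := Real.cos (polarAngle ξ) with hC
  set S := Real.sin (polarAngle ξ) with hS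
  have hCS : S ^ 2 + C ^ 2 = 1 := Real.sin_sq_add_cos_sq _
  have hee : ⟪e, e⟫ = 1 := by rw [real_inner_self_eq_norm_sq, ne]; norm_num
  have hxx : ⟪x, x⟫ = 1 := by rw [real_inner_self_eq_norm_sq, nξ]; norm_num
  have hex : ⟪e, x⟫ = C := by rw [real_inner_comm, hc]
  rw [hc] at hab
  have ha : a = Real.cos (polarAngle ζ) := by
    rw [← hcζ, hab, inner_add_right, inner_smul_right, inner_smul_right, inner_sub_right,
      inner_smul_right, hee, hex]
    ring
  have hζx : ⟪(ζ : Euc (d + 1)), x⟫ = a * C + b * S ^ 2 := by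
    rw [hab, inner_add_left, inner_smul_left, inner_smul_left, inner_sub_left,
      inner_smul_left, hex, hxx]
    simp only [conj_trivial]
    linear_combination b * (-hCS)
  have hζe : ⟪(ζ : Euc (d + 1)), e⟫ = a := by
    rw [real_inner_comm, hcζ, ha]
  have hbS : b * S = Real.sin (polarAngle ζ) := by
    have h1 : ⟪a • e + b • (x - C • e), (ζ : Euc (d + 1))⟫ = 1 := by
      rw [← hab, real_inner_self_eq_norm_sq, nζ]; norm_num
    rw [inner_add_left, inner_smul_left, inner_smul_left, inner_sub_left, inner_smul_left,
      real_inner_comm (ζ : Euc (d + 1)) e, real_inner_comm (ζ : Euc (d + 1)) x, hζx, hζe] at h1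
    simp only [conj_trivial] at h1
    have h2 : (b * S) ^ 2 = Real.sin (polarAngle ζ) ^ 2 := by
      rw [Real.sin_sq, ← ha]
      linear_combination h1
    exact (pow_left_inj₀ (by positivity) hsζ two_ne_zero).1 h2
  have hcosd : Real.cos (geodist ζ ξ) = Real.cos (polarAngle ξ - polarAngle ζ) := by
    rw [geodist_cos, Real.cos_sub, ← ha, ← hbS]
    rw [← hx, hζx]; ring
  have hr : geodist ζ ξ = polarAngle ξ - polarAngle ζ := by
    refine Real.injOn_cos (geodist_mem ζ ξ) ⟨by linarith, by linarith [hθm.2, hζm.1]⟩ hcosd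
  refine ⟨by rw [hr]; linarith, by rw [hr]; linarith [hθm.2, hζm.1], ?_⟩
  rw [hr, Real.sin_sub, ← ha, ← hbS]
  have h3 : ⟪(ζ : Euc (d + 1)), e⟫ = C * ⟪(ζ : Euc (d + 1)), x⟫ + S * ⟪(ζ : Euc (d + 1)), gdir ξ (npole d)⟫ := by
    conv_lhs => rw [hve]
    rw [inner_add_right, inner_smul_right, inner_smul_right]
  rw [hζe, hζx] at h3
  have h4 : S * ⟪(ζ : Euc (d + 1)), gdir ξ (npole d)⟫ = S * (S * a - C * (b * S)) := by
    linear_combination -h3 - a * hCS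
  have := mul_left_cancel₀ hs.ne' h4
  rw [this]

lemma geodist_gcurve {d : ℕ} (ξ ζ : Sph d) (v : Euc (d + 1)) (hv : ‖v‖ = 1)
    (ho : ⟪(ξ : Euc (d + 1)), v⟫ = 0) (hsin : ⟪(ζ : Euc (d + 1)), v⟫ = Real.sin (geodist ζ ξ)) {h : ℝ}
    (h0 : 0 ≤ geodist ζ ξ - h) (h1 : geodist ζ ξ - h ≤ Real.pi) :
    geodist ζ (gcurve ξ v hv ho h) = geodist ζ ξ - h := by
  conv_lhs => unfold geodist gcurve
  simp only
  rw [inner_add_right, inner_smul_right, inner_smul_right, hsin, ← geodist_cos]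
  have : Real.cos h * Real.cos (geodist ζ ξ) + Real.sin h * Real.sin (geodist ζ ξ) =
      Real.cos (geodist ζ ξ - h) := by rw [Real.cos_sub]; ring
  rw [this, Real.arccos_cos h0 h1]

lemma grad_perp {d : ℕ} (β : ℝ) (f : Sph d → ℝ) (hfpol : IsPolar f) (ξ : Sph d) (G : Euc (d + 1))
    (hξ : ξ ≠ npole d ∧ ξ ≠ spole d) (hdiff : HasSphereGradAt (sphMax β f) G ξ)
    (u : Euc (d + 1)) (hu : ‖u‖ = 1) (h1 : ⟪(ξ : Euc (d + 1)), u⟫ = 0)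
    (h2 : ⟪gdir ξ (npole d), u⟫ = 0) : ⟪G, u⟫ = 0 := by
  obtain ⟨-, -, hve⟩ := gdir_unit ξ hξ
  set T : Euc (d + 1) ≃ₗᵢ[ℝ] Euc (d + 1) := (Submodule.span ℝ {u})ᗮ.reflection with hT
  have hfix : ∀ x, ⟪x, u⟫ = 0 → T x = x := by
    intro x hx
    rw [hT, Submodule.reflection_eq_self_iff, Submodule.mem_orthogonal_singleton_iff_inner_left]
    exact hx
  have hTu : T u = -u := Submodule.reflection_orthogonalComplement_singleton_eq_neg u
  have hTT : ∀ x, T (T x) = x := fun x => Submodule.reflection_reflection _ x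
  have hTe : T (npole d : Euc (d + 1)) = (npole d : Euc (d + 1)) := by
    apply hfix
    rw [hve, inner_add_left, inner_smul_left, inner_smul_left, h1, h2]
    simp
  have hTf : ∀ η, f (sphAct T η) = f η := by
    intro η
    apply hfpol
    have : ⟪T (η : Euc (d + 1)), T (npole d : Euc (d + 1))⟫ = ⟪(η : Euc (d + 1)), (npole d : Euc (d + 1))⟫ :=
      T.inner_map_map _ _
    rw [hTe] at this
    exact this
  have hd := gcurve_deriv _ G ξ hdiff u hu h1
  have hsym : ∀ t, sphMax β f (gcurve ξ u hu h1 (-t)) = sphMax β f (gcurve ξ u hu h1 t) := by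
    intro t
    rw [← sphMax_act β f T hTf hTT (gcurve ξ u hu h1 t)]
    congr 1
    apply Subtype.ext
    simp only [sphAct, gcurve]
    rw [map_add, map_smul, map_smul, hTu, hfix _ h1]
    simp
  have hd' : HasDerivAt (fun t => sphMax β f (gcurve ξ u hu h1 t)) (-⟪G, u⟫) 0 := by
    have hd0 : HasDerivAt (fun t => sphMax β f (gcurve ξ u hu h1 t)) ⟪G, u⟫ (-0) := by simpa using hd
    have := hd0.scomp (0:ℝ) (hasDerivAt_neg (0:ℝ))
    simp only [neg_smul, one_smul] at this
    refine this.congr_of_eventuallyEq (Eventually.of_forall fun t => ?_)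
    exact (hsym t).symm
  have := hd.unique hd'
  linarith

lemma grad_norm {d : ℕ} (β : ℝ) (f : Sph d → ℝ) (hfpol : IsPolar f) (ξ : Sph d) (G : Euc (d + 1))
    (hξ : ξ ≠ npole d ∧ ξ ≠ spole d) (hdiff : HasSphereGradAt (sphMax β f) G ξ)
    (hnn : 0 ≤ ⟪G, gdir ξ (npole d)⟫) : ‖G‖ = ⟪G, gdir ξ (npole d)⟫ := by
  obtain ⟨hv1, hv0, -⟩ := gdir_unit ξ hξ
  set v := gdir ξ (npole d) with hv
  set w := G - ⟪G, v⟫ • v with hw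
  have hvv : ⟪v, v⟫ = 1 := by rw [real_inner_self_eq_norm_sq, hv1]; norm_num
  have w1 : ⟪(ξ : Euc (d + 1)), w⟫ = 0 := by
    rw [hw, inner_sub_right, inner_smul_right, hv0, real_inner_comm, hdiff.1]; ring
  have w2 : ⟪v, w⟫ = 0 := by
    rw [hw, inner_sub_right, inner_smul_right, hvv, real_inner_comm]; ring
  have hw0 : w = 0 := by
    by_contra hne
    have hn : ‖w‖ ≠ 0 := norm_ne_zero_iff.2 hne
    have h := grad_perp β f hfpol ξ G hξ hdiff (‖w‖⁻¹ • w) (by rw [norm_smul]; simp [hn])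
      (by rw [inner_smul_right, w1, mul_zero]) (by rw [inner_smul_right, ← hv, w2, mul_zero])
    rw [inner_smul_right, mul_eq_zero, or_iff_right (inv_ne_zero hn)] at h
    have : ⟪w, w⟫ = 0 := by
      conv_lhs => rw [hw, inner_sub_left, inner_smul_left, ← hw, h, w2]
      simp
    exact hne (inner_self_eq_zero.1 this)
  have hG : G = ⟪G, v⟫ • v := by rw [← sub_eq_zero]; exact hw0
  conv_lhs => rw [hG]
  rw [norm_smul, hv1, mul_one, Real.norm_of_nonneg hnn]

end

/-- **Lemma for large radii (preparation).** For nonnegative Lipschitz `f ∈ W^{1,1}_pol(𝕊^d)`,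
`ξ ∉ {𝐞, -𝐞}`, a best ball `B̄(ζ,r) ∈ 𝐁_ξ^β` with `ζ` on the half great circle through
`𝐞, ξ, -𝐞`, `0 ≤ θ(ζ) < θ(ξ)`, `ξ ∈ ∂𝓑(ζ,r)`, and `𝓜̃_β f` differentiable at `ξ`:
`∇𝓜̃_β f(ξ)·v(ξ,𝐞) = r^β (σ'(r)/σ(r)) ⨍_B ∇f(η)·v(η,ζ) (σ(d(ζ,η))/σ'(d(ζ,η))) dσ(η)
 - β r^{β-1} ⨍_B f`, and in particular
`|∇𝓜̃_β f(ξ)| ≤ r^β (σ'(r)/σ(r)) (⨍_B f - ⨍_{∂B} f)`. -/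
theorem gradient_formula_large_radii (d : ℕ) (hd : 1 ≤ d) (β : ℝ) (hβ0 : 0 < β) (hβd : β < d)
    (f : Sph d → ℝ) (g : Sph d → Euc (d + 1))
    (hf : MemW11 f g) (hfpol : IsPolar f) (hnn : ∀ ξ, 0 ≤ f ξ)
    (hlip : ∃ K : NNReal, LipschitzWith K f)
    (ξ ζ : Sph d) (r : ℝ) (G : Euc (d + 1))
    (hξ : ξ ≠ npole d ∧ ξ ≠ spole d)
    (hζ : OnHalfGreatCircle ξ ζ)
    (hθ : polarAngle ζ < polarAngle ξ)
    (hbdry : geodist ζ ξ = r)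
    (hball : IsBestBall β f ξ ζ r)
    (hdiff : HasSphereGradAt (sphMax β f) G ξ) :
    ⟪G, gdir ξ (npole d)⟫ =
      r ^ β * (sinPow d r / sinInt d r) *
        (⨍ η in gball ζ r,
          ⟪g η, gdir η ζ⟫ * (sinInt d (geodist ζ η) / sinPow d (geodist ζ η))
            ∂(sphMeasure d))
      - β * r ^ (β - 1) * (⨍ η in gball ζ r, f η ∂(sphMeasure d)) ∧
    ‖G‖ ≤ r ^ β * (sinPow d r / sinInt d r) *
      ((⨍ η in gball ζ r, f η ∂(sphMeasure d)) -
        ⨍ η in gsphere ζ r, f η ∂(sphBdry d)) := by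
  obtain ⟨K, hK⟩ := hlip
  have hfc : Continuous f := hK.continuous
  obtain ⟨hr0, hrpi, hsin⟩ := circle_geom ξ ζ hξ hζ hθ
  have hvs := gdir_unit ξ hξ
  obtain ⟨hv, ho, -⟩ := hvs
  subst hbdry
  obtain ⟨L, hL, hL2⟩ := exists_frame d ζ
  obtain ⟨c, hc0, hc⟩ := polar_formula d hd ζ L hL
  have hN : 0 < (volume : Measure (Euc d)).toSphere.real Set.univ := by
    have : Nonempty (Fin d) := ⟨⟨0, hd⟩⟩
    have h1 : (volume : Measure (Euc d)).toSphere Set.univ ≠ 0 := by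
      rw [Ne, Measure.measure_univ_eq_zero]
      exact Measure.toSphere_ne_zero _
    exact ENNReal.toReal_pos h1 (measure_ne_top _ _)
  have hbint := fun (s : ℝ) => ball_int d ζ L hL c hc f hfc (s := s)
  have hbmeas := fun (s : ℝ) => ball_meas d ζ L hL c hc (s := s)
  have hgrad := grad_radial d hd ζ L hL c hc f g hf hfc hr0 hrpi
  have hbdr := bdry_avg d hd ζ L hL hL2 hr0 hrpi f hfc
  have hFc : Continuous (fun t => sMean ζ L hL f t * Real.sin t ^ (d - 1)) :=
    (sMean_cont ζ L hL f hfc).mul (by fun_prop)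
  have hSpos := sinInt_pos d hr0 hrpi.le
  set N := (volume : Measure (Euc d)).toSphere.real Set.univ with hNdef
  have habs : (fun η => |f η|) = f := by
    funext η; exact abs_of_nonneg (hnn η)
  have havg : ∀ s : ℝ, 0 < s → s ≤ Real.pi → ⨍ η in gball ζ s, f η ∂(sphMeasure d) =
      (∫ t in (0:ℝ)..s, sMean ζ L hL f t * Real.sin t ^ (d - 1)) / (N * sinInt d s) := by
    intro s h0 h1
    have hS := sinInt_pos d h0 h1
    rw [setAverage_eq, smul_eq_mul, hbint _ h0 h1, hbmeas _ h0 h1]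
    field_simp
  have hder : HasDerivAt (fun s : ℝ => s ^ β *
      ((∫ t in (0:ℝ)..s, sMean ζ L hL f t * Real.sin t ^ (d - 1)) / (N * sinInt d s)))
      _ (geodist ζ ξ) :=
    (Real.hasDerivAt_rpow_const (p := β) (Or.inl hr0.ne')).mul
      ((intervalIntegral.integral_hasDerivAt_right (hFc.intervalIntegrable _ _)
        (hFc.stronglyMeasurableAtFilter _ _) hFc.continuousAt).div
        ((sinInt_hasDerivAt d _).const_mul N) (by positivity))
  have hmaxder := gcurve_deriv (sphMax β f) G ξ hdiff (gdir ξ (npole d)) hv ho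
  have hge : ∀ h : ℝ, 0 < geodist ζ ξ - h → geodist ζ ξ - h ≤ Real.pi → 
      (geodist ζ ξ - h) ^ β * ((∫ t in (0:ℝ)..(geodist ζ ξ - h), sMean ζ L hL f t * Real.sin t ^ (d - 1)) /
        (N * sinInt d (geodist ζ ξ - h))) ≤ sphMax β f (gcurve ξ (gdir ξ (npole d)) hv ho h) := by
    intro h h0 h1
    have := sphMax_ge β hβ0 f hfc (gcurve ξ (gdir ξ (npole d)) hv ho h) ζ _ h0 h1
      (geodist_gcurve ξ ζ _ hv ho hsin h0.le h1).le
    rwa [habs, havg _ h0 h1] at this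
  have heq := hball.2.2.2
  rw [habs] at heq
  have hmono : ∀ h : ℝ, 0 ≤ h → h < geodist ζ ξ →
      sphMax β f ξ ≤ sphMax β f (gcurve ξ (gdir ξ (npole d)) hv ho h) := by
    intro h h0 h1
    rw [heq]
    have := sphMax_ge β hβ0 f hfc (gcurve ξ (gdir ξ (npole d)) hv ho h) ζ _ hr0 hrpi.le
      (by rw [geodist_gcurve ξ ζ _ hv ho hsin (by linarith) (by linarith)]; linarith)
    rwa [habs] at this
  have hGnn : 0 ≤ ⟪G, gdir ξ (npole d)⟫ := by
    have h1 := (hasDerivWithinAt_iff_tendsto_slope' (s := Set.Ioi (0:ℝ)) (by simp)).1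
      hmaxder.hasDerivWithinAt
    refine ge_of_tendsto h1 ?_
    filter_upwards [Ioo_mem_nhdsGT hr0] with h hh
    rw [slope_def_field]
    refine div_nonneg ?_ (by linarith [hh.1])
    rw [gcurve_zero]
    linarith [hmono h hh.1.le hh.2]
  have hsub : HasDerivAt (fun h : ℝ => geodist ζ ξ - h) (-1) 0 := by
    simpa using (hasDerivAt_id (0:ℝ)).const_sub (geodist ζ ξ)
  have hcomp := HasDerivAt.comp (0:ℝ) (by rw [sub_zero]; exact hder) hsub
  have hDd := hmaxder.sub hcomp
  have hmin : IsLocalMin ((fun t => sphMax β f (gcurve ξ (gdir ξ (npole d)) hv ho t)) -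
      ((fun s : ℝ => s ^ β *
      ((∫ t in (0:ℝ)..s, sMean ζ L hL f t * Real.sin t ^ (d - 1)) / (N * sinInt d s))) ∘
      fun h : ℝ => geodist ζ ξ - h)) 0 := by
    have hnb : Set.Ioo (geodist ζ ξ - Real.pi) (geodist ζ ξ) ∈ 𝓝 (0:ℝ) :=
      Ioo_mem_nhds (by linarith) hr0
    filter_upwards [hnb] with h hh
    have h1 := hge h (by linarith [hh.2]) (by linarith [hh.1])
    simp only [Pi.sub_apply, Function.comp_apply, sub_zero]
    rw [gcurve_zero, heq, havg _ hr0 hrpi.le]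
    linarith
  have hzero := hmin.hasDerivAt_eq_zero hDd
  have hform : ⟪G, gdir ξ (npole d)⟫ =
      geodist ζ ξ ^ β * (sinPow d (geodist ζ ξ) / sinInt d (geodist ζ ξ)) *
        (⨍ η in gball ζ (geodist ζ ξ),
          ⟪g η, gdir η ζ⟫ * (sinInt d (geodist ζ η) / sinPow d (geodist ζ η))
            ∂(sphMeasure d))
      - β * geodist ζ ξ ^ (β - 1) * (⨍ η in gball ζ (geodist ζ ξ), f η ∂(sphMeasure d)) := by
    rw [sub_eq_zero.1 hzero, havg _ hr0 hrpi.le, setAverage_eq, smul_eq_mul, hgrad,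
      hbmeas _ hr0 hrpi.le, sinPow]
    field_simp
    ring
  refine ⟨hform, ?_⟩
  rw [grad_norm β f hfpol ξ G hξ hdiff hGnn, hform]
  have hkey : (⨍ η in gball ζ (geodist ζ ξ),
          ⟪g η, gdir η ζ⟫ * (sinInt d (geodist ζ η) / sinPow d (geodist ζ η))
            ∂(sphMeasure d)) = (⨍ η in gball ζ (geodist ζ ξ), f η ∂(sphMeasure d)) -
        ⨍ η in gsphere ζ (geodist ζ ξ), f η ∂(sphBdry d) := by
    rw [hbdr, havg _ hr0 hrpi.le, setAverage_eq, smul_eq_mul, hgrad, hbmeas _ hr0 hrpi.le]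
    field_simp
  rw [hkey]
  have hfnn : 0 ≤ ⨍ η in gball ζ (geodist ζ ξ), f η ∂(sphMeasure d) := by
    rw [setAverage_eq, smul_eq_mul]
    exact mul_nonneg (inv_nonneg.2 measureReal_nonneg) (integral_nonneg hnn)
  have hr1 : 0 ≤ geodist ζ ξ ^ (β - 1) := Real.rpow_nonneg hr0.le _
  have : 0 ≤ β * geodist ζ ξ ^ (β - 1) * ⨍ η in gball ζ (geodist ζ ξ), f η ∂(sphMeasure d) :=
    mul_nonneg (mul_nonneg hβ0.le hr1) hfnn
  exact sub_le_self _ this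

end
end

section
/- Suppose $g\in L^1(\mathbb{S}^d)$ is polar and $\mathcal{B}:=\mathcal{B}(\zeta,r)\subset\mathbb{S}^d\setminus\big(\mathcal{B}(\mathbf{e},2r)\cup\mathcal{B}(-\mathbf{e},2r)\big)$. Then $\fint_{[\theta(\zeta)-r,\,\theta(\zeta)+r]} |g(t)|\,dt \le C(d)\,\fint_{\mathcal{B}(\zeta,2r)}|g|\,d\sigma$, where in the one-dimensional integral $g(t)$ denotes the one-dimensional profile of $g$ (i.e. $g(t)=g(\eta)$ for any $\eta$ with $\theta(\eta)=t$) and the average is with respect to Lebesgue measure on the interval. -/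
open MeasureTheory Metric Filter Topology Asymptotics
open scoped ENNReal RealInnerProductSpace NNReal

noncomputable section

lemma sph_inner_self {d : ℕ} (ξ : Sph d) : ‖(ξ : Euc (d + 1))‖ = 1 := by
  simpa using ξ.2

lemma geodist_eq_angle {d : ℕ} (ξ η : Sph d) :
    geodist ξ η = InnerProductGeometry.angle (ξ : Euc (d + 1)) (η : Euc (d + 1)) := by
  simp [geodist, InnerProductGeometry.angle, sph_inner_self]

lemma cos_geodist {d : ℕ} (ξ η : Sph d) :
    Real.cos (geodist ξ η) = ⟪(ξ : Euc (d + 1)), (η : Euc (d + 1))⟫ := by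
  rw [geodist_eq_angle, InnerProductGeometry.cos_angle]
  simp [sph_inner_self]

lemma dist_sq_geodist {d : ℕ} (ξ η : Sph d) :
    dist ξ η ^ 2 = 2 - 2 * Real.cos (geodist ξ η) := by
  rw [cos_geodist, Subtype.dist_eq, dist_eq_norm, norm_sub_sq_real, sph_inner_self, sph_inner_self]
  ring

lemma geodist_nonneg {d : ℕ} (ξ η : Sph d) : 0 ≤ geodist ξ η := Real.arccos_nonneg _

lemma geodist_le_pi {d : ℕ} (ξ η : Sph d) : geodist ξ η ≤ Real.pi := Real.arccos_le_pi _

lemma dist_le_geodist {d : ℕ} (ξ η : Sph d) : dist ξ η ≤ geodist ξ η := by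
  refine abs_le_of_sq_le_sq' ?_ (geodist_nonneg _ _) |>.2
  rw [dist_sq_geodist]
  have := Real.one_sub_sq_div_two_le_cos (x := geodist ξ η)
  linarith

lemma geodist_le_dist {d : ℕ} (ξ η : Sph d) : geodist ξ η ≤ 2 * dist ξ η := by
  refine abs_le_of_sq_le_sq' ?_ (by positivity) |>.2
  rw [mul_pow, dist_sq_geodist]
  have h := Real.cos_le_one_sub_mul_cos_sq (x := geodist ξ η)
    (by rw [abs_of_nonneg (geodist_nonneg _ _)]; exact geodist_le_pi _ _)
  have h2 : 1 / 8 ≤ 2 / Real.pi ^ 2 := by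
    rw [div_le_div_iff₀ (by norm_num) (by positivity)]
    nlinarith [Real.pi_le_four, Real.pi_pos]
  nlinarith [sq_nonneg (geodist ξ η)]

lemma polarAngle_lip {d : ℕ} (ξ η : Sph d) :
    |polarAngle ξ - polarAngle η| ≤ 2 * dist ξ η := by
  have h1 : polarAngle ξ ≤ polarAngle η + geodist ξ η := by
    have := InnerProductGeometry.angle_le_angle_add_angle
      (npole d : Euc (d + 1)) (η : Euc (d + 1)) (ξ : Euc (d + 1))
    rw [InnerProductGeometry.angle_comm (η : Euc (d + 1))] at this
    simpa only [polarAngle, geodist_eq_angle] using this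
  have h2 : polarAngle η ≤ polarAngle ξ + geodist ξ η := by
    have := InnerProductGeometry.angle_le_angle_add_angle
      (npole d : Euc (d + 1)) (ξ : Euc (d + 1)) (η : Euc (d + 1))
    simpa only [polarAngle, geodist_eq_angle] using this
  have := geodist_le_dist ξ η
  rw [abs_le]; constructor <;> linarith

lemma sphMeasure_apply {d : ℕ} (S : Set (Sph d)) :
    sphMeasure d S = Measure.hausdorffMeasure (d : ℝ) S := by
  have hm : MeasurableEmbedding (Subtype.val : Sph d → Euc (d + 1)) :=
    MeasurableEmbedding.subtype_coe Metric.isClosed_sphere.measurableSet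
  rw [sphMeasure, hm.comap_apply]
  exact isometry_subtype_coe.hausdorffMeasure_image (Or.inl (by positivity)) S

lemma hausdorff_le_of_anti {X Y : Type*} [MetricSpace X] [MeasurableSpace X] [BorelSpace X]
    [MetricSpace Y] [MeasurableSpace Y] [BorelSpace Y] (P : X → Y) (B : Set X) (K : ℝ≥0)
    (d : ℝ) (hd : 0 ≤ d)
    (h : ∀ x ∈ B, ∀ y ∈ B, dist x y ≤ K * dist (P x) (P y)) :
    Measure.hausdorffMeasure d B ≤ (K : ℝ≥0∞) ^ d * Measure.hausdorffMeasure d (P '' B) := by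
  have ha : AntilipschitzWith K (fun x : B => P x) := by
    apply AntilipschitzWith.of_le_mul_dist
    intro x y
    exact h x x.2 y y.2
  have h1 := ha.le_hausdorffMeasure_image hd Set.univ
  have h2 := (isometry_subtype_coe (s := B)).hausdorffMeasure_image (Or.inl hd) Set.univ
  rw [← h2] at h1
  have h3 : (fun x : B => P x) '' Set.univ = P '' B := by
    ext z; simp
  have h4 : (Subtype.val '' (Set.univ : Set B)) = B := by
    ext z; simp
  rwa [h3, h4] at h1

lemma exists_frame_one {d : ℕ} (ζ : Sph d) :
    ∃ b : OrthonormalBasis (Fin (d + 1)) ℝ (Euc (d + 1)), b 0 = (ζ : Euc (d + 1)) := by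
  have hv : Orthonormal ℝ (Set.domRestrict ({0} : Set (Fin (d + 1)))
      (fun _ => (ζ : Euc (d + 1)))) := by
    constructor
    · intro i
      exact sph_inner_self ζ
    · rintro ⟨i, hi⟩ ⟨j, hj⟩ hij
      exfalso
      apply hij
      simp only [Set.mem_singleton_iff] at hi hj
      simp [hi, hj]
  obtain ⟨b, hb⟩ := hv.exists_orthonormalBasis_extension_of_card_eq (by simp)
  exact ⟨b, hb 0 (by simp)⟩

lemma exists_frame_two {m : ℕ} (ζ : Sph (m + 1)) (hs : 0 < Real.sin (polarAngle ζ)) :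
    ∃ b : OrthonormalBasis (Fin (m + 2)) ℝ (Euc (m + 2)),
      b 0 = (npole (m + 1) : Euc (m + 2)) ∧
      (ζ : Euc (m + 2)) = Real.cos (polarAngle ζ) • b 0 + Real.sin (polarAngle ζ) • b 1 := by
  set e : Euc (m + 2) := (npole (m + 1) : Euc (m + 2)) with he
  set s := Real.sin (polarAngle ζ) with hsdef
  set c := Real.cos (polarAngle ζ) with hc
  have hcs : c ^ 2 + s ^ 2 = 1 := by rw [hc, hsdef]; exact Real.cos_sq_add_sin_sq _
  have hin : ⟪e, (ζ : Euc (m + 2))⟫ = c := by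
    rw [hc, polarAngle, cos_geodist]
  have hne : ‖e‖ = 1 := sph_inner_self _
  have hnz : ‖(ζ : Euc (m + 2))‖ = 1 := sph_inner_self _
  set w : Euc (m + 2) := s⁻¹ • ((ζ : Euc (m + 2)) - c • e) with hw
  have hew : ⟪e, w⟫ = 0 := by
    rw [hw, real_inner_smul_right, inner_sub_right, real_inner_smul_right, hin,
      real_inner_self_eq_norm_sq, hne]
    ring
  have hnw : ‖w‖ = 1 := by
    have : ‖(ζ : Euc (m + 2)) - c • e‖ ^ 2 = s ^ 2 := by
      rw [norm_sub_sq_real, real_inner_smul_right, real_inner_comm, hin, norm_smul, hne, hnz,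
        mul_one, Real.norm_eq_abs, sq_abs]
      linarith
    have h2 : ‖(ζ : Euc (m + 2)) - c • e‖ = s := by
      rwa [sq_eq_sq₀ (norm_nonneg _) hs.le] at this
    rw [hw, norm_smul, h2, norm_inv, Real.norm_eq_abs, abs_of_pos hs]
    field_simp
  have hv : Orthonormal ℝ (Set.domRestrict ({0, 1} : Set (Fin (m + 2)))
      (fun i => if i = 0 then e else w)) := by
    constructor
    · rintro ⟨i, hi⟩
      simp only [Set.domRestrict_apply]
      split_ifs <;> assumption
    · rintro ⟨i, hi⟩ ⟨j, hj⟩ hij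
      simp only [Set.mem_insert_iff, Set.mem_singleton_iff] at hi hj
      simp only [Set.domRestrict_apply]
      rcases hi with rfl | rfl <;> rcases hj with rfl | rfl
      · exact absurd rfl hij
      · simpa using hew
      · simpa [real_inner_comm] using hew
      · exact absurd rfl hij
  obtain ⟨b, hb⟩ := hv.exists_orthonormalBasis_extension_of_card_eq (by simp)
  have hb0 : b 0 = e := by simpa using hb 0 (by simp)
  have hb1 : b 1 = w := by simpa using hb 1 (by simp)
  refine ⟨b, hb0, ?_⟩
  rw [hb0, hb1, hw, smul_smul, mul_inv_cancel₀ hs.ne', one_smul]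
  abel

lemma exists_point {m : ℕ} (b : OrthonormalBasis (Fin (m + 2)) ℝ (Euc (m + 2)))
    (t : ℝ) (y : Fin m → ℝ) (hy : ∑ i, y i ^ 2 ≤ Real.sin t ^ 2) :
    ∃ ξ : Sph (m + 1), ⟪b 0, (ξ : Euc (m + 2))⟫ = Real.cos t ∧
      ⟪b 1, (ξ : Euc (m + 2))⟫ = Real.sqrt (Real.sin t ^ 2 - ∑ i, y i ^ 2) ∧
      ∀ i : Fin m, ⟪b i.succ.succ, (ξ : Euc (m + 2))⟫ = y i := by
  set z : Fin (m + 2) → ℝ :=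
    Fin.cons (Real.cos t) (Fin.cons (Real.sqrt (Real.sin t ^ 2 - ∑ i, y i ^ 2)) y) with hz
  set x : Euc (m + 2) := b.repr.symm (WithLp.toLp 2 z) with hx
  have hc : ∀ i, ⟪b i, x⟫ = z i := by
    intro i
    rw [← b.repr_apply_apply, hx]
    simp
  have hn : ‖x‖ = 1 := by
    have h2 : ‖x‖ ^ 2 = 1 := by
      rw [hx, LinearIsometryEquiv.norm_map, EuclideanSpace.norm_sq_eq]
      simp only [Real.norm_eq_abs, sq_abs]
      rw [Fin.sum_univ_succ, Fin.sum_univ_succ]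
      simp only [hz, Fin.cons_zero, Fin.cons_succ]
      rw [Real.sq_sqrt (by linarith)]
      have := Real.cos_sq_add_sin_sq t
      linarith
    have := norm_nonneg x
    nlinarith
  refine ⟨⟨x, by simpa using hn⟩, ?_, ?_, ?_⟩
  · rw [hc 0]; simp [hz]
  · rw [hc 1]
    change z (Fin.succ 0) = _
    simp [hz]
  · intro i
    rw [hc]; simp [hz]

lemma half_le_sin {t r : ℝ} (h1 : r ≤ t) (h2 : t ≤ Real.pi - r) (hr : 0 < r) :
    r / 2 ≤ Real.sin t := by
  have hp : 1 / 2 ≤ 2 / Real.pi := by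
    rw [div_le_div_iff₀ (by norm_num) Real.pi_pos]
    linarith [Real.pi_le_four]
  rcases le_total t (Real.pi / 2) with h | h
  · have := Real.mul_le_sin (x := t) (by linarith) h
    nlinarith
  · have := Real.mul_le_sin (x := Real.pi - t) (by linarith) (by linarith)
    rw [Real.sin_pi_sub] at this
    nlinarith

lemma numeric {t θ r q : ℝ} (hr : 0 < r) (hq0 : 0 ≤ q) (hq : q ≤ r ^ 2 / 64)
    (h1 : 2 * r ≤ θ) (h2 : θ ≤ Real.pi - 2 * r) (h3 : θ - r ≤ t) (h4 : t ≤ θ + r) :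
    q ≤ Real.sin t ^ 2 ∧
      Real.cos (2 * r) < Real.cos θ * Real.cos t +
        Real.sin θ * Real.sqrt (Real.sin t ^ 2 - q) := by
  have hs : r / 2 ≤ Real.sin t := half_le_sin (by linarith) (by linarith) hr
  have hs0 : 0 ≤ Real.sin θ := Real.sin_nonneg_of_nonneg_of_le_pi (by linarith) (by linarith)
  have hss : Real.sin θ ≤ Real.sin t + r := by
    have h : |Real.sin θ - Real.sin t| ≤ |θ - t| := by
      simpa [Real.dist_eq] using Real.lipschitzWith_sin.dist_le_mul θ t
    have h' : |θ - t| ≤ r := by rw [abs_le]; constructor <;> linarith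
    have := (abs_le.1 (h.trans h')).2
    linarith
  have hqs : q ≤ Real.sin t ^ 2 := by nlinarith
  refine ⟨hqs, ?_⟩
  set s := Real.sin t with hsd
  set s0 := Real.sin θ with hs0d
  have hspos : 0 < s := by linarith
  have hsqrt : s - q / s ≤ Real.sqrt (s ^ 2 - q) := by
    apply Real.le_sqrt_of_sq_le
    have h5 : q / s * s = q := by field_simp
    have h6 : 0 ≤ q / s := by positivity
    have h7 : q / s ≤ s := by rw [div_le_iff₀ hspos]; nlinarith
    nlinarith
  have h8 : s0 * (q / s) ≤ 3 * q := by
    have : s0 * (q / s) = (s0 / s) * q := by ring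
    rw [this]
    apply mul_le_mul_of_nonneg_right _ hq0
    rw [div_le_iff₀ hspos]; linarith
  have h9 : s0 * (s - q / s) ≤ s0 * Real.sqrt (s ^ 2 - q) :=
    mul_le_mul_of_nonneg_left hsqrt hs0
  have h10 : Real.cos r ≤ Real.cos θ * Real.cos t + s0 * s := by
    rw [hs0d, hsd, ← Real.cos_sub, ← Real.cos_abs (θ - t)]
    apply Real.cos_le_cos_of_nonneg_of_le_pi (abs_nonneg _) (by linarith)
    rw [abs_le]; constructor <;> linarith
  have h11 : r ^ 2 / 8 ≤ 1 - Real.cos r := by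
    have h := Real.cos_le_one_sub_mul_cos_sq (x := r)
      (by rw [abs_of_pos hr]; linarith)
    have h2 : 1 / 8 ≤ 2 / Real.pi ^ 2 := by
      rw [div_le_div_iff₀ (by norm_num) (by positivity)]
      nlinarith [Real.pi_le_four, Real.pi_pos]
    nlinarith [sq_nonneg r]
  have h12 : 0 ≤ Real.cos r := Real.cos_nonneg_of_neg_pi_div_two_le_of_le
    (by linarith) (by linarith)
  have h13 := Real.cos_two_mul r
  have hr2 : 0 < r ^ 2 := by positivity
  nlinarith

lemma norm_sq_frame {d : ℕ} (b : OrthonormalBasis (Fin (d + 1)) ℝ (Euc (d + 1)))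
    (x : Euc (d + 1)) : ‖x‖ ^ 2 = ⟪b 0, x⟫ ^ 2 + ∑ i : Fin d, ⟪b i.succ, x⟫ ^ 2 := by
  rw [← LinearIsometryEquiv.norm_map b.repr x, EuclideanSpace.norm_sq_eq, Fin.sum_univ_succ]
  simp only [Real.norm_eq_abs, sq_abs, b.repr_apply_apply]

lemma anti_aux {d : ℕ} (hd : 1 ≤ d) {c : ℝ} (hc : 0 < c)
    (b : OrthonormalBasis (Fin (d + 1)) ℝ (Euc (d + 1)))
    (ξ η : Sph d) (hξ : c ≤ ⟪b 0, (ξ : Euc (d + 1))⟫) (hη : c ≤ ⟪b 0, (η : Euc (d + 1))⟫) :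
    dist ξ η ≤ (d + d / c) * dist (fun i : Fin d => ⟪b i.succ, (ξ : Euc (d + 1))⟫)
      (fun i : Fin d => ⟪b i.succ, (η : Euc (d + 1))⟫) := by
  set p : Fin d → ℝ := fun i => ⟪b i.succ, (ξ : Euc (d + 1))⟫ with hp
  set q : Fin d → ℝ := fun i => ⟪b i.succ, (η : Euc (d + 1))⟫ with hq
  set D := dist p q with hD
  have hD0 : 0 ≤ D := dist_nonneg
  set α := ⟪b 0, (ξ : Euc (d + 1))⟫ with hα
  set β := ⟪b 0, (η : Euc (d + 1))⟫ with hβ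
  have hd1 : (1 : ℝ) ≤ d := by exact_mod_cast hd
  have hpi : ∀ i, |p i - q i| ≤ D := fun i => by
    simpa [Real.dist_eq] using dist_le_pi_dist p q i
  have hle1 : ∀ (x : Sph d) (i), |⟪b i, (x : Euc (d + 1))⟫| ≤ 1 := by
    intro x i
    have := abs_real_inner_le_norm (b i) (x : Euc (d + 1))
    simpa [sph_inner_self] using this
  have h1 : α ^ 2 + ∑ i, p i ^ 2 = 1 := by
    rw [hα, hp, ← norm_sq_frame b, sph_inner_self]; norm_num
  have h2 : β ^ 2 + ∑ i, q i ^ 2 = 1 := by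
    rw [hβ, hq, ← norm_sq_frame b, sph_inner_self]; norm_num
  have h3 : dist ξ η ^ 2 = (α - β) ^ 2 + ∑ i, (p i - q i) ^ 2 := by
    rw [Subtype.dist_eq, dist_eq_norm, norm_sq_frame b]
    simp only [inner_sub_right, hα, hβ, hp, hq]
  have h4 : ∑ i, (p i - q i) ^ 2 ≤ d * D ^ 2 := by
    calc ∑ i, (p i - q i) ^ 2 ≤ ∑ i : Fin d, D ^ 2 := by
          apply Finset.sum_le_sum
          intro i _
          rw [← sq_abs]
          exact pow_le_pow_left₀ (abs_nonneg _) (hpi i) 2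
      _ = d * D ^ 2 := by simp
  have h5 : |(α - β) * (α + β)| ≤ d * (2 * D) := by
    have : (α - β) * (α + β) = ∑ i, (q i - p i) * (q i + p i) := by
      have : ∑ i, (q i - p i) * (q i + p i) = ∑ i, q i ^ 2 - ∑ i, p i ^ 2 := by
        rw [← Finset.sum_sub_distrib]
        apply Finset.sum_congr rfl
        intro i _; ring
      rw [this]; linarith
    rw [this]
    calc |∑ i, (q i - p i) * (q i + p i)| ≤ ∑ i, |(q i - p i) * (q i + p i)| :=
          Finset.abs_sum_le_sum_abs _ _
      _ ≤ ∑ i : Fin d, 2 * D := by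
          apply Finset.sum_le_sum
          intro i _
          rw [abs_mul, mul_comm, abs_sub_comm]
          have hh : |q i + p i| ≤ 2 := by
            have := abs_add_le (q i) (p i)
            have h7 := hle1 ξ i.succ
            have h8 := hle1 η i.succ
            simp only [hp, hq] at this ⊢
            linarith
          exact mul_le_mul hh (hpi i) (abs_nonneg _) (by norm_num)
      _ = d * (2 * D) := by simp
  have h6 : |α - β| ≤ d / c * D := by
    rw [abs_mul, abs_of_nonneg (show 0 ≤ α + β by linarith)] at h5
    have : |α - β| * (2 * c) ≤ d * (2 * D) :=
      (mul_le_mul_of_nonneg_left (by linarith) (abs_nonneg _)).trans h5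
    rw [div_mul_eq_mul_div, le_div_iff₀ hc]
    linarith
  have hK : 0 ≤ (d + d / c) * D := by positivity
  refine abs_le_of_sq_le_sq' ?_ hK |>.2
  rw [h3, ← sq_abs]
  have h7 : |α - β| ^ 2 ≤ (d / c * D) ^ 2 := pow_le_pow_left₀ (abs_nonneg _) h6 2
  have h8 : d * D ^ 2 ≤ (d * D) ^ 2 := by
    rw [mul_pow]
    apply mul_le_mul_of_nonneg_right _ (sq_nonneg _)
    nlinarith
  have h9 : 0 ≤ (d / c * D) * (d * D) := by positivity
  nlinarith

lemma upper_bound {d : ℕ} (hd : 1 ≤ d) {c : ℝ} (hc : 0 < c) (ζ : Sph d) {r : ℝ} (hr : 0 < r)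
    (hr2 : 2 * r ≤ Real.pi) (hcr : c ≤ Real.cos (2 * r)) :
    sphMeasure d (gball ζ (2 * r)) ≤ ENNReal.ofReal (((d + d / c) * (4 * r)) ^ d) := by
  obtain ⟨b, hb⟩ := exists_frame_one ζ
  set P : Sph d → (Fin d → ℝ) := fun ξ i => ⟪b i.succ, (ξ : Euc (d + 1))⟫ with hP
  have hK : 0 ≤ (d + d / c : ℝ) := by positivity
  have hcos : ∀ ξ ∈ gball ζ (2 * r), c ≤ ⟪b 0, (ξ : Euc (d + 1))⟫ := by
    intro ξ hξ
    rw [hb, ← cos_geodist]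
    refine hcr.trans ?_
    exact Real.cos_le_cos_of_nonneg_of_le_pi (geodist_nonneg _ _) hr2 (le_of_lt hξ)
  have h1 := hausdorff_le_of_anti P (gball ζ (2 * r)) (d + d / c : ℝ).toNNReal (d : ℝ)
    (by positivity) (by
      intro x hx y hy
      rw [Real.coe_toNNReal _ hK]
      exact anti_aux hd hc b x y (hcos x hx) (hcos y hy))
  rw [← sphMeasure_apply] at h1
  have h2 : P '' gball ζ (2 * r) ⊆ Set.pi Set.univ (fun _ => Set.Icc (-(2 * r)) (2 * r)) := by
    rintro _ ⟨ξ, hξ, rfl⟩ i -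
    have hz : ⟪b i.succ, (ζ : Euc (d + 1))⟫ = 0 := by
      rw [← hb]
      exact b.orthonormal.2 (Fin.succ_ne_zero i)
    have h3 : |⟪b i.succ, (ξ : Euc (d + 1)) - (ζ : Euc (d + 1))⟫| ≤ 2 * r := by
      have h4 := abs_real_inner_le_norm (b i.succ) ((ξ : Euc (d + 1)) - (ζ : Euc (d + 1)))
      have h5 := dist_le_geodist ζ ξ
      rw [dist_comm, Subtype.dist_eq, dist_eq_norm] at h5
      have h6 : geodist ζ ξ < 2 * r := hξ
      rw [b.orthonormal.1, one_mul] at h4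
      linarith
    rw [inner_sub_right, hz, sub_zero] at h3
    exact abs_le.1 h3
  have h3 : (Measure.hausdorffMeasure (d : ℝ)) (P '' gball ζ (2 * r)) ≤
      ENNReal.ofReal (4 * r) ^ d := by
    have h4 := hausdorffMeasure_pi_real (ι := Fin d)
    rw [Fintype.card_fin] at h4
    rw [h4]
    refine (measure_mono h2).trans ?_
    rw [volume_pi_pi]
    simp only [Real.volume_Icc, Finset.prod_const, Finset.card_univ, Fintype.card_fin]
    apply le_of_eq
    congr 2; ring
  refine h1.trans ?_
  rw [ENNReal.rpow_natCast, mul_pow, ENNReal.ofReal_mul (by positivity), ENNReal.ofReal_pow hK,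
    ENNReal.ofReal_pow (by positivity)]
  gcongr
  exact le_refl _

lemma lower_bound {m : ℕ} (ζ : Sph (m + 1)) {r : ℝ} (hr : 0 < r)
    (h1 : 2 * r ≤ polarAngle ζ) (h2 : polarAngle ζ ≤ Real.pi - 2 * r)
    (A : Set ℝ) (hA : A ⊆ Set.Icc (polarAngle ζ - r) (polarAngle ζ + r)) :
    volume A * ENNReal.ofReal (r / (4 * (m + 1))) ^ m ≤
      2 ^ (m + 1) * sphMeasure (m + 1) (gball ζ (2 * r) ∩ polarAngle ⁻¹' A) := by
  obtain ⟨b, hb0, hb⟩ := exists_frame_two ζ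
    (Real.sin_pos_of_pos_of_lt_pi (by linarith) (by linarith))
  set F : Sph (m + 1) → (Fin (m + 1) → ℝ) := fun ξ =>
    Fin.cons (polarAngle ξ) (fun i : Fin m => ⟪b i.succ.succ, (ξ : Euc (m + 2))⟫) with hF
  have hlip : LipschitzWith 2 F := by
    apply LipschitzWith.of_dist_le_mul
    intro x y
    rw [dist_pi_le_iff (by positivity)]
    intro i
    refine Fin.cases ?_ (fun j => ?_) i
    · simpa [hF, Real.dist_eq] using polarAngle_lip x y
    · simp only [hF, Fin.cons_succ, Real.dist_eq, ← inner_sub_right]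
      have h4 := abs_real_inner_le_norm (b j.succ.succ) ((x : Euc (m + 2)) - (y : Euc (m + 2)))
      rw [b.orthonormal.1, one_mul, ← dist_eq_norm, ← Subtype.dist_eq] at h4
      have : 0 ≤ dist x y := dist_nonneg
      push_cast
      linarith
  set ε : ℝ := r / (8 * (m + 1)) with hε
  have hε0 : 0 < ε := by positivity
  set Q : Fin (m + 1) → Set ℝ := Fin.cons A (fun _ => Set.Icc (-ε) ε) with hQ
  have hsub : Set.pi Set.univ Q ⊆ F '' (gball ζ (2 * r) ∩ polarAngle ⁻¹' A) := by
    intro z hz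
    have hz0 : z 0 ∈ A := by simpa [hQ] using hz 0 (Set.mem_univ _)
    have hzi : ∀ i : Fin m, |z i.succ| ≤ ε := fun i => by
      have := hz i.succ (Set.mem_univ _)
      simp only [hQ, Fin.cons_succ] at this
      exact abs_le.2 this
    have hI := hA hz0
    set q := ∑ i : Fin m, (z i.succ) ^ 2 with hq
    have hq0 : 0 ≤ q := Finset.sum_nonneg (fun i _ => sq_nonneg _)
    have hq1 : q ≤ r ^ 2 / 64 := by
      have : q ≤ m * ε ^ 2 := by
        calc q ≤ ∑ i : Fin m, ε ^ 2 := by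
              apply Finset.sum_le_sum
              intro i _
              rw [← sq_abs]
              exact pow_le_pow_left₀ (abs_nonneg _) (hzi i) 2
          _ = m * ε ^ 2 := by simp
      have h5 : r = 8 * (m + 1) * ε := by rw [hε]; field_simp
      have h6 : (0 : ℝ) ≤ m := by positivity
      have h7 : 0 ≤ ε ^ 2 := sq_nonneg _
      have h8 : r ^ 2 / 64 = (m + 1) ^ 2 * ε ^ 2 := by rw [h5]; ring
      rw [h8]
      refine this.trans (mul_le_mul_of_nonneg_right ?_ h7)
      nlinarith
    obtain ⟨h5, h6⟩ := numeric hr hq0 hq1 h1 h2 hI.1 hI.2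
    obtain ⟨ξ, hξ0, hξ1, hξ⟩ := exists_point b (z 0) (fun i => z i.succ) h5
    have hpol : polarAngle ξ = z 0 := by
      rw [polarAngle, geodist, ← hb0, hξ0]
      exact Real.arccos_cos (by linarith [hI.1]) (by linarith [hI.2])
    refine ⟨ξ, ⟨?_, ?_⟩, ?_⟩
    · have h7 : Real.cos (2 * r) < Real.cos (geodist ζ ξ) := by
        rw [cos_geodist, hb, inner_add_left, real_inner_smul_left, real_inner_smul_left,
          hξ0, hξ1]
        exact h6
      by_contra hcon
      have h8 : 2 * r ≤ geodist ζ ξ := not_lt.1 hcon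
      have := Real.cos_le_cos_of_nonneg_of_le_pi (by linarith) (geodist_le_pi ζ ξ) h8
      linarith
    · change polarAngle ξ ∈ A
      rwa [hpol]
    · funext i
      refine Fin.cases ?_ (fun j => ?_) i
      · simpa [hF] using hpol
      · simpa [hF] using hξ j
  have hvol : volume (Set.pi Set.univ Q) = volume A * ENNReal.ofReal (r / (4 * (m + 1))) ^ m := by
    rw [volume_pi_pi, Fin.prod_univ_succ]
    simp only [hQ, Fin.cons_zero, Fin.cons_succ, Real.volume_Icc, Finset.prod_const,
      Finset.card_univ, Fintype.card_fin]
    congr 3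
    rw [hε]; field_simp; norm_num
  have h4 := hausdorffMeasure_pi_real (ι := Fin (m + 1))
  rw [Fintype.card_fin] at h4
  rw [← hvol, ← h4, sphMeasure_apply]
  refine (measure_mono hsub).trans ?_
  refine (hlip.hausdorffMeasure_image_le (by positivity) _).trans ?_
  rw [ENNReal.rpow_natCast]
  simp

lemma radius_bound {m : ℕ} (ζ : Sph (m + 1)) {r : ℝ} (hr : 0 < r)
    (h : gball ζ r ⊆ (gball (npole (m + 1)) (2 * r) ∪ gball (spole (m + 1)) (2 * r))ᶜ) :
    3 * r ≤ polarAngle ζ ∧ polarAngle ζ ≤ Real.pi - 2 * r := by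
  have hζ : ζ ∈ gball ζ r := by
    have : geodist ζ ζ = 0 := by
      rw [geodist, real_inner_self_eq_norm_sq, sph_inner_self]; simp
    change geodist ζ ζ < r
    rwa [this]
  have key : ∀ ξ ∈ gball ζ r, 2 * r ≤ polarAngle ξ ∧ polarAngle ξ ≤ Real.pi - 2 * r := by
    intro ξ hξ
    have := h hξ
    rw [Set.mem_compl_iff, Set.mem_union, not_or] at this
    have h1 : 2 * r ≤ geodist (npole (m + 1)) ξ := not_lt.1 this.1
    have h2 : 2 * r ≤ geodist (spole (m + 1)) ξ := not_lt.1 this.2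
    have h3 : geodist (spole (m + 1)) ξ = Real.pi - polarAngle ξ := by
      rw [polarAngle, geodist, geodist, ← Real.arccos_neg, ← inner_neg_left]
      rfl
    refine ⟨h1, ?_⟩
    linarith
  obtain ⟨h1, h2⟩ := key ζ hζ
  refine ⟨?_, h2⟩
  by_contra! hcon
  set θ := polarAngle ζ with hθ
  obtain ⟨b, hb0, hb⟩ := exists_frame_two ζ
    (Real.sin_pos_of_pos_of_lt_pi (by linarith) (by linarith))
  set s := (θ - r) / 2 with hs
  obtain ⟨ξ, hξ0, hξ1, hξ⟩ := exists_point b (θ - s) (fun _ => 0) (by simp; positivity)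
  have hsn : 0 ≤ Real.sin (θ - s) :=
    Real.sin_nonneg_of_nonneg_of_le_pi (by linarith) (by linarith)
  have hpol : polarAngle ξ = θ - s := by
    rw [polarAngle, geodist, ← hb0, hξ0]
    exact Real.arccos_cos (by linarith) (by linarith)
  have hg : geodist ζ ξ = s := by
    rw [geodist, hb, inner_add_left, real_inner_smul_left, real_inner_smul_left, hξ0, hξ1]
    have h0 : Real.sqrt (Real.sin (θ - s) ^ 2 - ∑ i : Fin m, (0 : ℝ) ^ 2) = Real.sin (θ - s) := by
      simp [Real.sqrt_sq hsn]
    rw [h0, ← Real.cos_sub, sub_sub_cancel]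
    exact Real.arccos_cos (by linarith) (by linarith)
  have := (key ξ (by change geodist ζ ξ < r; rw [hg]; linarith)).1
  rw [hpol] at this
  linarith

lemma continuous_polarAngle {d : ℕ} : Continuous (polarAngle : Sph d → ℝ) := by
  unfold polarAngle geodist
  fun_prop

lemma lintegral_lower {m : ℕ} (ζ : Sph (m + 1)) {r : ℝ} (hr : 0 < r)
    (h1 : 2 * r ≤ polarAngle ζ) (h2 : polarAngle ζ ≤ Real.pi - 2 * r) (f : ℝ → ℝ≥0∞) :
    ENNReal.ofReal (r / (4 * (m + 1))) ^ m *
        ∫⁻ t in Set.Icc (polarAngle ζ - r) (polarAngle ζ + r), f t ≤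
      2 ^ (m + 1) * ∫⁻ η in gball ζ (2 * r), f (polarAngle η) ∂(sphMeasure (m + 1)) := by
  have hmeas : Measurable (polarAngle : Sph (m + 1) → ℝ) := continuous_polarAngle.measurable
  set I := Set.Icc (polarAngle ζ - r) (polarAngle ζ + r) with hI
  set ν := ((sphMeasure (m + 1)).restrict (gball ζ (2 * r))).map polarAngle with hν
  have hle : (ENNReal.ofReal (r / (4 * (m + 1))) ^ m) • (volume.restrict I) ≤
      ((2 : ℝ≥0∞) ^ (m + 1)) • ν := by
    rw [Measure.le_iff]
    intro s hs
    rw [Measure.smul_apply, Measure.smul_apply, smul_eq_mul, smul_eq_mul,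
      Measure.restrict_apply hs, hν, Measure.map_apply hmeas hs,
      Measure.restrict_apply (hmeas hs), mul_comm]
    refine (lower_bound ζ hr h1 h2 (s ∩ I) Set.inter_subset_right).trans ?_
    refine mul_le_mul_right (measure_mono ?_) _
    intro x hx
    exact ⟨hx.2.1, hx.1⟩
  calc _ = ∫⁻ t, f t ∂((ENNReal.ofReal (r / (4 * (m + 1))) ^ m) • (volume.restrict I)) := by
        rw [lintegral_smul_measure, smul_eq_mul]
    _ ≤ ∫⁻ t, f t ∂(((2 : ℝ≥0∞) ^ (m + 1)) • ν) := lintegral_mono' hle le_rfl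
    _ = 2 ^ (m + 1) * ∫⁻ t, f t ∂ν := by rw [lintegral_smul_measure, smul_eq_mul]
    _ ≤ _ := by
        gcongr
        exact lintegral_map_le _ _

/-- **Geometric proposition.** If `g ∈ L¹(𝕊^d)` is polar with one-dimensional profile `g₁`
and `𝓑(ζ,r) ⊆ 𝕊^d \ (𝓑(𝐞,2r) ∪ 𝓑(-𝐞,2r))`, then
`⨍_{[θ(ζ)-r, θ(ζ)+r]} |g₁(t)| dt ≤ C(d) ⨍_{𝓑(ζ,2r)} |g| dσ`. -/
theorem polar_interval_average (d : ℕ) (hd : 1 ≤ d) :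
    ∃ C : ℝ, 0 < C ∧ ∀ (g : Sph d → ℝ) (g1 : ℝ → ℝ),
      Integrable g (sphMeasure d) → IsPolar g →
      (∀ η : Sph d, g1 (polarAngle η) = g η) →
      ∀ (ζ : Sph d) (r : ℝ), 0 < r →
        gball ζ r ⊆ (gball (npole d) (2 * r) ∪ gball (spole d) (2 * r))ᶜ →
        (⨍ t in Set.Icc (polarAngle ζ - r) (polarAngle ζ + r), |g1 t|) ≤
          C * ⨍ η in gball ζ (2 * r), |g η| ∂(sphMeasure d) := by
  obtain ⟨m, rfl⟩ : ∃ m, d = m + 1 := ⟨d - 1, by omega⟩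
  set c : ℝ := Real.cos (2 * Real.pi / 5) with hc
  have hc0 : 0 < c := Real.cos_pos_of_mem_Ioo
    ⟨by linarith [Real.pi_pos], by linarith [Real.pi_pos]⟩
  set K : ℝ := ((((m + 1 : ℕ) : ℝ) + ((m + 1 : ℕ) : ℝ) / c) * 4) ^ (m + 1) with hK
  have hK0 : 0 < K := by positivity
  set k : ℝ := (1 / (4 * (m + 1) : ℝ)) ^ m with hk
  have hk0 : 0 < k := by positivity
  refine ⟨2 ^ (m + 1) / k * K / 2, by positivity, ?_⟩
  intro g g1 hg _ hg1 ζ r hr hsub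
  obtain ⟨h3, h2⟩ := radius_bound ζ hr hsub
  have h1 : 2 * r ≤ polarAngle ζ := by linarith
  set B := gball ζ (2 * r) with hB
  set I := Set.Icc (polarAngle ζ - r) (polarAngle ζ + r) with hI
  have hnn : 0 ≤ ∫ η in B, |g η| ∂(sphMeasure (m + 1)) := integral_nonneg fun _ => abs_nonneg _
  rw [setAverage_eq, setAverage_eq, smul_eq_mul, smul_eq_mul]
  by_cases hint : Integrable (fun t => |g1 t|) (volume.restrict I)
  swap
  · rw [integral_undef hint, mul_zero]
    positivity
  -- measure bounds
  have hup : sphMeasure (m + 1) B ≤ ENNReal.ofReal (K * r ^ (m + 1)) := by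
    have := upper_bound hd hc0 ζ hr (by linarith) (by
      rw [hc]
      exact Real.cos_le_cos_of_nonneg_of_le_pi (by linarith) (by linarith [Real.pi_pos])
        (by linarith))
    refine this.trans (le_of_eq ?_)
    rw [hK, ← mul_pow, mul_assoc]
  have hupr : (sphMeasure (m + 1)).real B ≤ K * r ^ (m + 1) :=
    ENNReal.toReal_le_of_le_ofReal (by positivity) hup
  have hBpos : 0 < (sphMeasure (m + 1)).real B := by
    apply ENNReal.toReal_pos _ (ne_top_of_le_ne_top ENNReal.ofReal_ne_top hup)
    intro h0
    have := lower_bound ζ hr h1 h2 I subset_rfl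
    have h0' : sphMeasure (m + 1) (B ∩ polarAngle ⁻¹' I) = 0 :=
      measure_mono_null Set.inter_subset_left h0
    rw [h0', mul_zero, nonpos_iff_eq_zero, mul_eq_zero] at this
    rcases this with h | h
    · rw [hI, Real.volume_Icc, ENNReal.ofReal_eq_zero] at h
      linarith
    · have := eq_zero_of_pow_eq_zero h
      rw [ENNReal.ofReal_eq_zero] at this
      have h5 : 0 < r / (4 * ((m : ℝ) + 1)) := by positivity
      linarith
  have hIr : (volume : Measure ℝ).real I = 2 * r := by
    rw [hI, Real.volume_real_Icc_of_le (by linarith)]; ring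
  -- integral bound
  have hmain : k * r ^ m * ∫ t in I, |g1 t| ≤
      2 ^ (m + 1) * ∫ η in B, |g η| ∂(sphMeasure (m + 1)) := by
    have hl := lintegral_lower ζ hr h1 h2 (fun t => ENNReal.ofReal |g1 t|)
    simp only [hg1] at hl
    rw [← ofReal_integral_eq_lintegral_ofReal hint (ae_of_all _ fun _ => abs_nonneg _),
      ← ofReal_integral_eq_lintegral_ofReal hg.abs.integrableOn
        (ae_of_all _ fun _ => abs_nonneg _),
      ← ENNReal.ofReal_pow (by positivity), ← ENNReal.ofReal_mul (by positivity)] at hl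
    have h2' : (2 : ℝ≥0∞) ^ (m + 1) = ENNReal.ofReal (2 ^ (m + 1)) := by
      rw [ENNReal.ofReal_pow (by norm_num)]; simp
    rw [h2', ← ENNReal.ofReal_mul (by positivity),
      ENNReal.ofReal_le_ofReal_iff (by positivity)] at hl
    have h5 : (r / (4 * ((m : ℝ) + 1))) ^ m = k * r ^ m := by
      rw [hk, ← mul_pow]; congr 1; ring
    rwa [h5] at hl
  rw [hIr]
  set X := ∫ t in I, |g1 t|
  set Y := ∫ η in B, |g η| ∂(sphMeasure (m + 1))
  set V := (sphMeasure (m + 1)).real B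
  have hX : X ≤ 2 ^ (m + 1) * Y / (k * r ^ m) := by
    rw [le_div_iff₀ (by positivity)]; linarith
  have hV : (K * r ^ (m + 1))⁻¹ ≤ V⁻¹ := inv_anti₀ hBpos hupr
  calc (2 * r)⁻¹ * X ≤ (2 * r)⁻¹ * (2 ^ (m + 1) * Y / (k * r ^ m)) := by gcongr
    _ = 2 ^ (m + 1) / k * K / 2 * ((K * r ^ (m + 1))⁻¹ * Y) := by
        rw [pow_succ r m]
        clear_value K k X Y V
        field_simp
    _ ≤ _ := by gcongr

end
end
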